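/- Let G₁ and G₂ be discrete convergence groups acting on a compact metrizable space M, suppose J = G₁ ∩ G₂ is geometrically finite and a proper subgroup of both G₁ and G₂, and suppose G₁ and G₂ are in AFP ping-pong position with respect to J. Let G = ⟨G₁, G₂⟩ ≤ Homeo(M) and suppose G acts on M as a convergence group. Then G is geometrically finite if and only if both G₁ and G₂ are geometrically finite. -/

import Mathlib

open Filter Topology Set

namespace ConvergenceGroups

variable {M : Type*} [TopologicalSpace M]

/-- The group of self-homeomorphisms of `M`, with `(g * h) x = g (h x)`. -/
instance : Group (M ≃ₜ M) where
  mul g h := h.trans g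
  one := Homeomorph.refl M
  inv := Homeomorph.symm
  mul_assoc _ _ _ := rfl
  one_mul _ := Homeomorph.ext fun _ => rfl
  mul_one _ := Homeomorph.ext fun _ => rfl
  inv_mul_cancel g := Homeomorph.ext fun x => g.symm_apply_apply x

/-- The inclusion of the self-homeomorphisms of `M` into the continuous self-maps of `M`;
the latter carries the compact-open topology. -/
def toCM (g : M ≃ₜ M) : C(M, M) := ⟨⇑g, g.continuous⟩

/-- `(g k)` is a convergence sequence with attracting point `zp` and repelling point `zm`:
the maps `g k` converge to the constant map `zp` uniformly on compact subsets of
`M ∖ {zm}`. -/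
def IsConvSeq (g : ℕ → M ≃ₜ M) (zp zm : M) : Prop :=
  ∀ K : Set M, IsCompact K → zm ∉ K → ∀ U ∈ 𝓝 zp,
    ∀ᶠ k in atTop, ∀ x ∈ K, g k x ∈ U

/-- `(g k)` converges in the compact-open topology to a homeomorphism. -/
def TendstoHomeo (g : ℕ → M ≃ₜ M) : Prop :=
  ∃ h : M ≃ₜ M, Tendsto (fun k => toCM (g k)) atTop (𝓝 (toCM h))

/-- `G` acts on `M` as a convergence group: every sequence of pairwise distinct elements of
`G` has a subsequence which either converges in the compact-open topology to a
homeomorphism, or is a convergence sequence. -/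
def IsConvGroup (G : Subgroup (M ≃ₜ M)) : Prop :=
  ∀ g : ℕ → M ≃ₜ M, (∀ k, g k ∈ G) → Function.Injective g →
    ∃ φ : ℕ → ℕ, StrictMono φ ∧
      (TendstoHomeo (g ∘ φ) ∨ ∃ zp zm : M, IsConvSeq (g ∘ φ) zp zm)

/-- `G` acts on `M` as a discrete convergence group: every sequence of pairwise distinct
elements of `G` has a subsequence which is a convergence sequence. -/
def IsDiscreteConvGroup (G : Subgroup (M ≃ₜ M)) : Prop :=
  ∀ g : ℕ → M ≃ₜ M, (∀ k, g k ∈ G) → Function.Injective g →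
    ∃ φ : ℕ → ℕ, StrictMono φ ∧ ∃ zp zm : M, IsConvSeq (g ∘ φ) zp zm

/-- The limit set `Λ(G)`: the set of all attracting points of convergence sequences in `G`. -/
def limitSet (G : Subgroup (M ≃ₜ M)) : Set M :=
  {zp | ∃ g : ℕ → M ≃ₜ M, (∀ k, g k ∈ G) ∧ Function.Injective g ∧
    ∃ zm : M, IsConvSeq g zp zm}

/-- `x` is a conical limit point for `G`: there is a sequence of pairwise distinct elements
`g k` of `G` such that for every `z ≠ x` the pairs `(g k x, g k z)` remain in a compact
subset of `(M × M) ∖ Δ`. -/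
def IsConicalLimitPt (G : Subgroup (M ≃ₜ M)) (x : M) : Prop :=
  ∃ g : ℕ → M ≃ₜ M, (∀ k, g k ∈ G) ∧ Function.Injective g ∧
    ∀ z : M, z ≠ x → ∃ K : Set (M × M), IsCompact K ∧ (∀ p ∈ K, p.1 ≠ p.2) ∧
      ∀ k, (g k x, g k z) ∈ K

/-- `g` is elliptic: the closure of the cyclic group generated by `g` is compact in
`Homeo(M)` (viewed inside `C(M, M)` with the compact-open topology). -/
def IsEllipticElem (g : M ≃ₜ M) : Prop :=
  IsCompact (closure (Set.range fun n : ℤ => toCM (g ^ n))) ∧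
    closure (Set.range fun n : ℤ => toCM (g ^ n)) ⊆ Set.range (toCM (M := M))

/-- `g` is parabolic: not elliptic, and fixes exactly one point of `M`. -/
def IsParabolicElem (g : M ≃ₜ M) : Prop :=
  ¬IsEllipticElem g ∧ ∃! x : M, g x = x

/-- `g` is loxodromic: not elliptic, and fixes exactly two points of `M`. -/
def IsLoxodromicElem (g : M ≃ₜ M) : Prop :=
  ¬IsEllipticElem g ∧ ∃ a b : M, a ≠ b ∧ {x : M | g x = x} = {a, b}

/-- `p` is a parabolic point for `G`: it is the fixed point of a parabolic element of `G`. -/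
def IsParabolicPt (G : Subgroup (M ≃ₜ M)) (p : M) : Prop :=
  ∃ g ∈ G, IsParabolicElem g ∧ g p = p

/-- `p` is a bounded parabolic point for `G`: it is a parabolic point and the quotient of
`Λ(G) ∖ {p}` by the stabilizer of `p` in `G` is compact. -/
def IsBoundedParabolicPt (G : Subgroup (M ≃ₜ M)) (p : M) : Prop :=
  IsParabolicPt G p ∧
    ∃ K : Set M, IsCompact K ∧ K ⊆ limitSet G \ {p} ∧
      ∀ x ∈ limitSet G \ {p}, ∃ h ∈ G, h p = p ∧ h x ∈ K

/-- `G` is geometrically finite: every point of `Λ(G)` is a conical limit point or a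
bounded parabolic point. -/
def IsGeomFinite (G : Subgroup (M ≃ₜ M)) : Prop :=
  ∀ x ∈ limitSet G, IsConicalLimitPt G x ∨ IsBoundedParabolicPt G x

/-- `J` is a fully quasi-convex subgroup of `G`: `J ≤ G`, `J` acts geometrically finitely,
and `g Λ(J) ∩ Λ(J) = ∅` for all but finitely many left cosets `gJ`. -/
def IsFullyQuasiconvex (G J : Subgroup (M ≃ₜ M)) : Prop :=
  J ≤ G ∧ IsGeomFinite J ∧
    ∃ F : Set (M ≃ₜ M), F.Finite ∧ ∀ g ∈ G,
      (⇑g '' limitSet J ∩ limitSet J).Nonempty → ∃ f ∈ F, ∃ j ∈ J, g = f * j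

/-- `G₁` and `G₂` are in AFP ping-pong position with respect to `J = G₁ ∩ G₂`, witnessed by
the closed sets `B₁`, `B₂`. -/
structure AFPPingPong (G₁ G₂ J : Subgroup (M ≃ₜ M)) (B₁ B₂ : Set M) : Prop where
  isClosed₁ : IsClosed B₁
  isClosed₂ : IsClosed B₂
  int_nonempty₁ : (interior B₁).Nonempty
  int_nonempty₂ : (interior B₂).Nonempty
  int_disjoint : interior B₁ ∩ interior B₂ = ∅
  inv₁ : ∀ j ∈ J, ⇑j '' B₁ = B₁
  inv₂ : ∀ j ∈ J, ⇑j '' B₂ = B₂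
  pp₁ : ∀ g ∈ G₁, g ∉ J → ⇑g '' B₁ ⊆ interior B₂
  pp₂ : ∀ g ∈ G₂, g ∉ J → ⇑g '' B₂ ⊆ interior B₁
  lim₁ : limitSet G₁ \ limitSet J ⊆ interior B₂
  lim₂ : limitSet G₂ \ limitSet J ⊆ interior B₁

/-- `G₀` is in HNN ping-pong position with respect to `f`, `J₁`, `J₋₁`, witnessed by the
closed sets `B₁`, `Bm` (where `Bm` plays the role of `B₋₁`). -/
structure HNNPingPong (G₀ J₁ Jm : Subgroup (M ≃ₜ M)) (f : M ≃ₜ M) (B₁ Bm : Set M) :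
    Prop where
  isClosed₁ : IsClosed B₁
  isClosedm : IsClosed Bm
  int_nonempty₁ : (interior B₁).Nonempty
  int_nonemptym : (interior Bm).Nonempty
  int_disjoint : interior B₁ ∩ interior Bm = ∅
  inv₁ : ∀ j ∈ J₁, ⇑j '' B₁ = B₁
  invm : ∀ j ∈ Jm, ⇑j '' Bm = Bm
  prec₁ : ∀ g ∈ G₀, g ∉ J₁ → ⇑g '' B₁ ∩ B₁ = ∅
  precm : ∀ g ∈ G₀, g ∉ Jm → ⇑g '' Bm ∩ Bm = ∅
  cross : ∀ g ∈ G₀, ⇑g '' B₁ ∩ Bm = ∅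
  mapf : ⇑f '' ((B₁ ∪ Bm)ᶜ ∪ B₁) = interior B₁
  lim₁ : limitSet G₀ ∩ B₁ = limitSet J₁
  limm : limitSet G₀ ∩ Bm = limitSet Jm
  proper : (⋃ g ∈ G₀, ⇑g '' (B₁ ∪ Bm))ᶜ.Nonempty

/-- A letter of type `i` (`i = 0` for `G₁`, `i = 1` for `G₂`) for amalgamated free product
normal forms: an element of `G_{i+1} ∖ J`. -/
def AFPLetter (G₁ G₂ J : Subgroup (M ≃ₜ M)) (i : Fin 2) (g : M ≃ₜ M) : Prop :=
  g ∈ (if i = 0 then G₁ else G₂) ∧ g ∉ J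

/-- `h` is an `(i,j)`-form: a product of a nonempty alternating list of letters, whose first
letter lies in `G_i ∖ J` and whose last letter lies in `G_j ∖ J` (indices shifted so that
`0` stands for `G₁` and `1` for `G₂`). -/
def IsIJForm (G₁ G₂ J : Subgroup (M ≃ₜ M)) (i j : Fin 2) (h : M ≃ₜ M) : Prop :=
  ∃ l : List (M ≃ₜ M), l ≠ [] ∧ l.prod = h ∧
    (∀ g ∈ l, AFPLetter G₁ G₂ J 0 g ∨ AFPLetter G₁ G₂ J 1 g) ∧
    l.Chain' (fun a b => ∀ c : Fin 2, AFPLetter G₁ G₂ J c a → AFPLetter G₁ G₂ J (1 - c) b) ∧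
    (∀ hne : l ≠ [], AFPLetter G₁ G₂ J i (l.head hne)) ∧
    (∀ hne : l ≠ [], AFPLetter G₁ G₂ J j (l.getLast hne))

set_option linter.unusedSectionVars false

section Basics

@[simp] lemma homeo_mul_apply (g h : M ≃ₜ M) (x : M) : (g * h) x = g (h x) := rfl

@[simp] lemma homeo_one_apply (x : M) : (1 : M ≃ₜ M) x = x := rfl

@[simp] lemma homeo_inv_apply_self (g : M ≃ₜ M) (x : M) : g⁻¹ (g x) = x := g.symm_apply_apply x

@[simp] lemma homeo_apply_inv_self (g : M ≃ₜ M) (x : M) : g (g⁻¹ x) = x := g.apply_symm_apply x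

lemma homeo_eq_inv_apply {g : M ≃ₜ M} {x y : M} (h : g x = y) : x = g⁻¹ y := by
  rw [← h, homeo_inv_apply_self]

lemma homeo_inv_apply_eq {g : M ≃ₜ M} {x : M} (h : g x = x) : g⁻¹ x = x :=
  (homeo_eq_inv_apply h).symm

lemma homeo_apply_eq_of_inv {g : M ≃ₜ M} {x y : M} (h : g⁻¹ x = y) : x = g y := by
  rw [← h, homeo_apply_inv_self]

/-- Ramsey-type extraction for an equivalence-like relation. -/
lemma exists_subseq_rel_or_not {α : Type*} (r : α → α → Prop) (hs : ∀ a b, r a b → r b a)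
    (ht : ∀ a b c, r a b → r b c → r a c) (f : ℕ → α) :
    ∃ φ : ℕ → ℕ, StrictMono φ ∧
      ((∀ m n, m ≠ n → r (f (φ m)) (f (φ n))) ∨ (∀ m n, m ≠ n → ¬ r (f (φ m)) (f (φ n)))) := by
  have : IsTrans α r := ⟨ht⟩
  obtain ⟨g, hg⟩ := exists_increasing_or_nonincreasing_subseq r f
  refine ⟨g, g.strictMono, hg.imp (fun h m n hmn => ?_) (fun h m n hmn => ?_)⟩
  · rcases lt_or_gt_of_ne hmn with h1 | h1
    · exact h _ _ h1
    · exact hs _ _ (h _ _ h1)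
  · rcases lt_or_gt_of_ne hmn with h1 | h1
    · exact h _ _ h1
    · exact fun h2 => h _ _ h1 (hs _ _ h2)

lemma exists_subseq_const_or_injective {α : Type*} (f : ℕ → α) :
    ∃ φ : ℕ → ℕ, StrictMono φ ∧
      ((∀ n, f (φ n) = f (φ 0)) ∨ Function.Injective (f ∘ φ)) := by
  obtain ⟨φ, hφ, h⟩ := exists_subseq_rel_or_not (fun a b : α => a = b) (fun _ _ => Eq.symm)
    (fun _ _ _ => Eq.trans) f
  refine ⟨φ, hφ, h.imp (fun h n => ?_) (fun h m n hmn => ?_)⟩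
  · rcases eq_or_ne n 0 with rfl | h0
    · rfl
    · exact h _ _ h0
  · by_contra hne
    exact h _ _ hne hmn

lemma exists_injective_of_infinite {α : Type*} {S : ℕ → Set α} (h : ∀ n, (S n).Infinite) :
    ∃ f : ℕ → α, Function.Injective f ∧ ∀ n, f n ∈ S n := by
  classical
  choose g hg hg' using fun (n : ℕ) (F : Finset α) => (h n).exists_notMem_finset F
  let F : ℕ → Finset α := fun n => Nat.rec ∅ (fun n F => insert (g n F) F) n
  have hF : ∀ n, F (n + 1) = insert (g n (F n)) (F n) := fun n => rfl
  have hmono : Monotone F := monotone_nat_of_le_succ fun n => by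
    rw [hF]; exact Finset.subset_insert _ _
  have key : ∀ m n, m < n → g m (F m) ≠ g n (F n) := fun m n hmn heq => by
    apply hg' n (F n)
    rw [← heq]
    exact hmono hmn (by rw [hF]; exact Finset.mem_insert_self _ _)
  refine ⟨fun n => g n (F n), fun m n hmn => ?_, fun n => hg n _⟩
  rcases lt_trichotomy m n with h1 | h1 | h1
  · exact absurd hmn (key _ _ h1)
  · exact h1
  · exact absurd hmn.symm (key _ _ h1)

lemma IsConvSeq.comp_tendsto {g : ℕ → M ≃ₜ M} {a b : M} (h : IsConvSeq g a b) {φ : ℕ → ℕ}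
    (hφ : Tendsto φ atTop atTop) : IsConvSeq (g ∘ φ) a b :=
  fun K hK hb U hU => hφ.eventually (h K hK hb U hU)

lemma IsConvSeq.subseq {g : ℕ → M ≃ₜ M} {a b : M} (h : IsConvSeq g a b) {φ : ℕ → ℕ}
    (hφ : StrictMono φ) : IsConvSeq (g ∘ φ) a b :=
  h.comp_tendsto hφ.tendsto_atTop

lemma IsConvSeq.mul_left {g : ℕ → M ≃ₜ M} {a b : M} (h : IsConvSeq g a b) (c : M ≃ₜ M) :
    IsConvSeq (fun k => c * g k) (c a) b := fun K hK hb U hU =>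
  h K hK hb (c ⁻¹' U) (c.continuous.continuousAt hU)

lemma IsConvSeq.mul_right {g : ℕ → M ≃ₜ M} {a b : M} (h : IsConvSeq g a b) (c : M ≃ₜ M) :
    IsConvSeq (fun k => g k * c) a (c⁻¹ b) := fun K hK hb U hU => by
  have := h (c '' K) (hK.image c.continuous) (by
    rintro ⟨x, hx, rfl⟩
    exact hb (by simpa using hx)) U hU
  filter_upwards [this] with k hk x hx using hk _ (mem_image_of_mem c hx)

lemma exists_mem_ne_of_not_isOpen {b : M} (hb : ¬ IsOpen ({b} : Set M)) {O : Set M}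
    (hO : IsOpen O) (hne : O.Nonempty) : ∃ x ∈ O, x ≠ b := by
  by_contra! hcon
  exact hb (by rwa [← (Set.Nonempty.subset_singleton_iff hne).1 hcon])

variable [CompactSpace M] [TopologicalSpace.MetrizableSpace M]

lemma IsConvSeq.eventually_closed {g : ℕ → M ≃ₜ M} {a b : M} (h : IsConvSeq g a b) {K U : Set M}
    (hK : IsClosed K) (hb : b ∉ K) (hU : U ∈ 𝓝 a) : ∀ᶠ k in atTop, ∀ x ∈ K, g k x ∈ U :=
  h K hK.isCompact hb U hU

lemma IsConvSeq.inv {g : ℕ → M ≃ₜ M} {a b : M} (h : IsConvSeq g a b) :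
    IsConvSeq (fun k => (g k)⁻¹) b a := by
  intro K hK ha U hU
  have := h.eventually_closed (K := (interior U)ᶜ) isOpen_interior.isClosed_compl
    (by simpa using mem_interior_iff_mem_nhds.2 hU) (hK.isClosed.isOpen_compl.mem_nhds ha)
  filter_upwards [this] with k hk x hx
  by_contra hcon
  have := hk ((g k)⁻¹ x) (fun h => hcon (interior_subset h))
  simp [hx] at this

lemma IsConvSeq.tendsto {g : ℕ → M ≃ₜ M} {a b : M} (h : IsConvSeq g a b) {x : ℕ → M} {y : M}
    (hx : Tendsto x atTop (𝓝 y)) (hy : y ≠ b) : Tendsto (fun k => g k (x k)) atTop (𝓝 a) := by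
  refine tendsto_def.2 fun U hU => ?_
  obtain ⟨V, hV, hVc, hbV⟩ : ∃ V ∈ 𝓝 y, IsClosed V ∧ b ∉ V := by
    obtain ⟨V, hV, hVc, hVs⟩ := exists_mem_nhds_isClosed_subset (isOpen_ne.mem_nhds hy)
    exact ⟨V, hV, hVc, fun h => hVs h rfl⟩
  filter_upwards [h.eventually_closed hVc hbV hU, hx.eventually_mem hV] with k h1 h2
  exact h1 _ h2

lemma IsConvSeq.tendsto_apply {g : ℕ → M ≃ₜ M} {a b : M} (h : IsConvSeq g a b) {x : M}
    (hx : x ≠ b) : Tendsto (fun k => g k x) atTop (𝓝 a) :=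
  h.tendsto tendsto_const_nhds hx

lemma IsConvSeq.congr_eventually {g g' : ℕ → M ≃ₜ M} {a b : M} (h : IsConvSeq g a b)
    (hg : ∀ᶠ k in atTop, g k = g' k) : IsConvSeq g' a b := fun K hK hb U hU => by
  filter_upwards [h K hK hb U hU, hg] with k h1 h2 x hx
  rw [← h2]; exact h1 x hx

variable [Infinite M]

lemma exists_ne_ne (b c : M) : ∃ x : M, x ≠ b ∧ x ≠ c := by
  classical
  obtain ⟨x, hx⟩ := Infinite.exists_notMem_finset ({b, c} : Finset M)
  simp only [Finset.mem_insert, Finset.mem_singleton, not_or] at hx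
  exact ⟨x, hx⟩

lemma IsConvSeq.unique_left {g : ℕ → M ≃ₜ M} {a b a' b' : M} (h : IsConvSeq g a b)
    (h' : IsConvSeq g a' b') : a = a' := by
  obtain ⟨x, h1, h2⟩ := exists_ne_ne b b'
  exact tendsto_nhds_unique (h.tendsto_apply h1) (h'.tendsto_apply h2)

lemma IsConvSeq.unique_right {g : ℕ → M ≃ₜ M} {a b a' b' : M} (h : IsConvSeq g a b)
    (h' : IsConvSeq g a' b') : b = b' :=
  h.inv.unique_left h'.inv

lemma IsConvSeq.not_isOpen_right {g : ℕ → M ≃ₜ M} {a b : M} (h : IsConvSeq g a b) :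
    ¬ IsOpen ({b} : Set M) := by
  intro hb
  obtain ⟨x, hxa, -⟩ := exists_ne_ne a a
  obtain ⟨y, hya, hyx⟩ := exists_ne_ne a x
  have hU : ({x, y}ᶜ : Set M) ∈ 𝓝 a :=
    (Set.toFinite {x, y}).isClosed.isOpen_compl.mem_nhds (by simp [hxa.symm, hya.symm])
  obtain ⟨k, hk⟩ := (h.eventually_closed (K := {b}ᶜ) hb.isClosed_compl (by simp) hU).exists
  have aux : ∀ z ∈ ({x, y} : Set M), (g k)⁻¹ z = b := fun z hz => by
    by_contra hne
    have := hk ((g k)⁻¹ z) hne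
    rw [homeo_apply_inv_self] at this
    exact this hz
  have := (aux x (by simp)).trans (aux y (by simp)).symm
  exact hyx ((g k)⁻¹.injective this).symm

lemma IsConvSeq.not_isOpen_left {g : ℕ → M ≃ₜ M} {a b : M} (h : IsConvSeq g a b) :
    ¬ IsOpen ({a} : Set M) := h.inv.not_isOpen_right

/-- If a convergence sequence maps a set with nonempty interior into a closed set, then its
attracting point lies in that closed set. -/
lemma IsConvSeq.left_mem_of_frequently {g : ℕ → M ≃ₜ M} {a b : M} (h : IsConvSeq g a b)
    {O C : Set M} (hO : IsOpen O) (hne : O.Nonempty) (hC : IsClosed C)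
    (hm : ∃ᶠ k in atTop, ∀ x ∈ O, g k x ∈ C) : a ∈ C := by
  obtain ⟨x, hx, hxb⟩ := exists_mem_ne_of_not_isOpen h.not_isOpen_right hO hne
  exact hC.mem_of_frequently_of_tendsto (hm.mono fun k hk => hk x hx) (h.tendsto_apply hxb)

end Basics

section Groups

variable [CompactSpace M] [TopologicalSpace.MetrizableSpace M]

lemma IsDiscreteConvGroup.mono {G H : Subgroup (M ≃ₜ M)} (hG : IsDiscreteConvGroup G)
    (h : H ≤ G) : IsDiscreteConvGroup H := fun g hg hi => hG g (fun k => h (hg k)) hi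

lemma limitSet_mono {G H : Subgroup (M ≃ₜ M)} (h : H ≤ G) : limitSet H ⊆ limitSet G := by
  rintro x ⟨g, hg, hi, b, hb⟩
  exact ⟨g, fun k => h (hg k), hi, b, hb⟩

lemma IsConvSeq.mem_limitSet {G : Subgroup (M ≃ₜ M)} {g : ℕ → M ≃ₜ M} {a b : M}
    (h : IsConvSeq g a b) (hg : ∀ k, g k ∈ G) (hi : Function.Injective g) : a ∈ limitSet G :=
  ⟨g, hg, hi, b, h⟩

lemma injective_inv_seq {g : ℕ → M ≃ₜ M} (hi : Function.Injective g) :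
    Function.Injective fun k => (g k)⁻¹ := fun _ _ h => hi (inv_injective h)

lemma IsConvSeq.mem_limitSet_right {G : Subgroup (M ≃ₜ M)} {g : ℕ → M ≃ₜ M} {a b : M}
    (h : IsConvSeq g a b) (hg : ∀ k, g k ∈ G) (hi : Function.Injective g) : b ∈ limitSet G :=
  h.inv.mem_limitSet (fun k => G.inv_mem (hg k)) (injective_inv_seq hi)

lemma apply_mem_limitSet {G : Subgroup (M ≃ₜ M)} {x : M} (hx : x ∈ limitSet G) {c : M ≃ₜ M}
    (hc : c ∈ G) : c x ∈ limitSet G := by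
  obtain ⟨g, hg, hi, b, hb⟩ := hx
  exact (hb.mul_left c).mem_limitSet (fun k => G.mul_mem hc (hg k))
    (fun _ _ h => hi (mul_left_cancel h))

lemma apply_mem_limitSet_iff {G : Subgroup (M ≃ₜ M)} {x : M} {c : M ≃ₜ M} (hc : c ∈ G) :
    c x ∈ limitSet G ↔ x ∈ limitSet G :=
  ⟨fun h => by simpa using apply_mem_limitSet h (G.inv_mem hc), fun h => apply_mem_limitSet h hc⟩

lemma isClosed_limitSet (G : Subgroup (M ≃ₜ M)) : IsClosed (limitSet G) := by
  refine IsSeqClosed.isClosed fun u x hu hx => ?_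
  choose g hg hi b hb using hu
  obtain ⟨β, φ, hφ, hβ⟩ := CompactSpace.tendsto_subseq b
  obtain ⟨U, hU⟩ := (𝓝 x).exists_antitone_basis
  obtain ⟨V, hV⟩ := (𝓝 β).exists_antitone_basis
  have hinf : ∀ n, {c | c ∈ G ∧ ∀ y ∉ V n, c y ∈ U n}.Infinite := fun n => by
    have h1 : ∀ᶠ m in atTop, interior (U n) ∈ 𝓝 (u (φ m)) :=
      (hx.comp hφ.tendsto_atTop).eventually
        (isOpen_interior.mem_nhds (mem_interior_iff_mem_nhds.2 (hU.mem n)) |>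
          eventually_mem_nhds_iff.2)
    have h2 : ∀ᶠ m in atTop, b (φ m) ∈ interior (V n) :=
      hβ.eventually_mem (isOpen_interior.mem_nhds (mem_interior_iff_mem_nhds.2 (hV.mem n)))
    obtain ⟨m, h1, h2⟩ := (h1.and h2).exists
    have := (hb (φ m)).eventually_closed (K := (interior (V n))ᶜ) isOpen_interior.isClosed_compl
      (by simpa using h2) h1
    obtain ⟨N, hN⟩ := eventually_atTop.1 this
    refine ((Set.Ici_infinite N).image ((hi (φ m)).injOn)).mono ?_
    rintro _ ⟨k, hk, rfl⟩
    exact ⟨hg _ _, fun y hy => interior_subset (hN k hk y (fun h => hy (interior_subset h)))⟩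
  obtain ⟨f, hf, hfm⟩ := exists_injective_of_infinite hinf
  refine ⟨f, fun k => (hfm k).1, hf, β, fun K hK hβK W hW => ?_⟩
  obtain ⟨n, -, hn⟩ := hU.1.mem_iff.1 hW
  obtain ⟨m, -, hm⟩ := hV.1.mem_iff.1 (hK.isClosed.isOpen_compl.mem_nhds hβK)
  filter_upwards [eventually_ge_atTop n, eventually_ge_atTop m] with k h1 h2 y hy
  exact hn (hU.2 h1 ((hfm k).2 y fun h => hm (hV.2 h2 h) hy))

variable [Infinite M]

lemma exists_conicalSeq {G : Subgroup (M ≃ₜ M)} (hG : IsDiscreteConvGroup G) {x : M}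
    (hx : IsConicalLimitPt G x) : ∃ f : ℕ → M ≃ₜ M, (∀ k, f k ∈ G) ∧ Function.Injective f ∧
      ∃ a b : M, a ≠ b ∧ IsConvSeq f b x ∧ Tendsto (fun k => f k x) atTop (𝓝 a) := by
  obtain ⟨g, hg, hi, hz⟩ := hx
  obtain ⟨φ, hφ, b, c, hb⟩ := hG g hg hi
  obtain ⟨a, ψ, hψ, ha⟩ := CompactSpace.tendsto_subseq fun k => g (φ k) x
  have hb' := hb.subseq hψ
  have key : ∀ z, z ≠ x → z ≠ c → a ≠ b := fun z h1 h2 => by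
    obtain ⟨K, hK, hd, hm⟩ := hz z h1
    have : Tendsto (fun k => (g (φ (ψ k)) x, g (φ (ψ k)) z)) atTop (𝓝 (a, b)) :=
      ha.prodMk_nhds (hb'.tendsto_apply h2)
    exact hd _ (hK.isClosed.mem_of_tendsto this (Eventually.of_forall fun k => hm _))
  have hc : c = x := by
    by_contra hne
    obtain ⟨z, h1, h2⟩ := exists_ne_ne x c
    exact key z h1 h2 (tendsto_nhds_unique ha (hb'.tendsto_apply (Ne.symm hne)))
  obtain ⟨z, h1, -⟩ := exists_ne_ne x x
  subst hc
  exact ⟨_, fun k => hg _, (hi.comp hφ.injective).comp hψ.injective, a, b, key z h1 h1, hb', ha⟩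

lemma isConicalLimitPt_of_conicalSeq {G : Subgroup (M ≃ₜ M)} {x a b : M} {f : ℕ → M ≃ₜ M}
    (hf : ∀ k, f k ∈ G) (hi : Function.Injective f) (hab : a ≠ b) (hb : IsConvSeq f b x)
    (ha : Tendsto (fun k => f k x) atTop (𝓝 a)) : IsConicalLimitPt G x := by
  refine ⟨f, hf, hi, fun z hz => ?_⟩
  have : Tendsto (fun k => (f k x, f k z)) atTop (𝓝 (a, b)) :=
    ha.prodMk_nhds (hb.tendsto_apply hz)
  refine ⟨_, this.isCompact_insert_range, ?_, fun k => mem_insert_of_mem _ ⟨k, rfl⟩⟩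
  rintro p (rfl | ⟨k, rfl⟩)
  · exact hab
  · exact fun h => hz ((f k).injective h).symm

lemma IsConicalLimitPt.mono {G H : Subgroup (M ≃ₜ M)} {x : M} (hx : IsConicalLimitPt H x)
    (h : H ≤ G) : IsConicalLimitPt G x := by
  obtain ⟨g, hg, hi, hz⟩ := hx
  exact ⟨g, fun k => h (hg k), hi, hz⟩

lemma IsConicalLimitPt.translate {G : Subgroup (M ≃ₜ M)} {x : M} (hx : IsConicalLimitPt G x)
    {c : M ≃ₜ M} (hc : c ∈ G) : IsConicalLimitPt G (c x) := by
  obtain ⟨g, hg, hi, hz⟩ := hx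
  refine ⟨fun k => g k * c⁻¹, fun k => G.mul_mem (hg k) (G.inv_mem hc),
    fun m n h => hi (mul_right_cancel h), fun z hne => ?_⟩
  obtain ⟨K, hK, hd, hm⟩ := hz (c⁻¹ z) (fun h => hne (homeo_apply_eq_of_inv h))
  exact ⟨K, hK, hd, fun k => by simpa using hm k⟩

lemma IsEllipticElem.of_conj {g c : M ≃ₜ M} (h : IsEllipticElem (c * g * c⁻¹)) :
    IsEllipticElem g := by
  let Ψ : C(M, M) → C(M, M) := fun f => (toCM c⁻¹).comp (f.comp (toCM c))
  have hΨ : Continuous Ψ := by fun_prop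
  have hpow : ∀ n : ℤ, (c * g * c⁻¹) ^ n = c * g ^ n * c⁻¹ := fun n => conj_zpow
  have hsub : closure (Set.range fun n : ℤ => toCM (g ^ n)) ⊆
      Ψ '' closure (Set.range fun n : ℤ => toCM ((c * g * c⁻¹) ^ n)) := by
    refine closure_minimal ?_ (h.1.image hΨ).isClosed
    rintro _ ⟨n, rfl⟩
    refine ⟨_, subset_closure ⟨n, rfl⟩, ?_⟩
    ext x
    change c⁻¹ (((c * g * c⁻¹) ^ n) (c x)) = (g ^ n) x
    simp [hpow]
  refine ⟨(h.1.image hΨ).of_isClosed_subset isClosed_closure hsub, hsub.trans ?_⟩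
  rintro _ ⟨f, hf, rfl⟩
  obtain ⟨k, rfl⟩ := h.2 hf
  exact ⟨c⁻¹ * (k * c), rfl⟩

lemma IsParabolicElem.conj {g : M ≃ₜ M} (hg : IsParabolicElem g) (c : M ≃ₜ M) :
    IsParabolicElem (c * g * c⁻¹) := by
  refine ⟨fun h => hg.1 h.of_conj, ?_⟩
  obtain ⟨p, hp, hu⟩ := hg.2
  refine ⟨c p, by simp [show g p = p from hp], fun y hy => homeo_apply_eq_of_inv (hu _ ?_)⟩
  have : g (c⁻¹ y) = c⁻¹ y := homeo_eq_inv_apply hy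
  exact this

lemma IsParabolicPt.translate {G : Subgroup (M ≃ₜ M)} {p : M} (hp : IsParabolicPt G p)
    {c : M ≃ₜ M} (hc : c ∈ G) : IsParabolicPt G (c p) := by
  obtain ⟨g, hg, hpar, hgp⟩ := hp
  exact ⟨c * g * c⁻¹, G.mul_mem (G.mul_mem hc hg) (G.inv_mem hc), hpar.conj c, by simp [hgp]⟩

lemma IsParabolicPt.mono {G H : Subgroup (M ≃ₜ M)} {p : M} (hp : IsParabolicPt H p)
    (h : H ≤ G) : IsParabolicPt G p := by
  obtain ⟨g, hg, hpar, hgp⟩ := hp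
  exact ⟨g, h hg, hpar, hgp⟩

lemma IsBoundedParabolicPt.translate {G : Subgroup (M ≃ₜ M)} {p : M}
    (hp : IsBoundedParabolicPt G p) {c : M ≃ₜ M} (hc : c ∈ G) :
    IsBoundedParabolicPt G (c p) := by
  obtain ⟨hpp, K, hK, hKs, hcov⟩ := hp
  refine ⟨hpp.translate hc, c '' K, hK.image c.continuous, ?_, fun x hx => ?_⟩
  · rintro _ ⟨y, hy, rfl⟩
    exact ⟨apply_mem_limitSet (hKs hy).1 hc, fun h => (hKs hy).2 (c.injective h)⟩
  · obtain ⟨h, hh, hhp, hhK⟩ := hcov (c⁻¹ x) ⟨apply_mem_limitSet hx.1 (G.inv_mem hc),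
      fun h => hx.2 (homeo_apply_eq_of_inv h)⟩
    exact ⟨c * h * c⁻¹, G.mul_mem (G.mul_mem hc hh) (G.inv_mem hc), by simp [hhp],
      ⟨_, hhK, rfl⟩⟩

lemma IsParabolicElem.injective_zpow {g : M ≃ₜ M} (hg : IsParabolicElem g) :
    Function.Injective fun n : ℤ => g ^ n := by
  rw [injective_zpow_iff_not_isOfFinOrder]
  intro hfin
  apply hg.1
  have h1 : (Set.range fun n : ℤ => toCM (g ^ n)).Finite := by
    have h2 : (Set.range fun n : ℤ => g ^ n).Finite := by
      have := hfin.finite_zpowers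
      exact this.subset (by rintro _ ⟨n, rfl⟩; exact ⟨n, rfl⟩)
    have h3 := h2.image toCM
    rwa [← Set.range_comp] at h3
  refine ⟨?_, ?_⟩
  · rw [h1.isClosed.closure_eq]; exact h1.isCompact
  · rw [h1.isClosed.closure_eq]
    rintro _ ⟨n, rfl⟩
    exact ⟨_, rfl⟩

/-- Powers of a parabolic element of a discrete convergence group push every point arbitrarily
close to the parabolic fixed point. -/
lemma IsParabolicElem.exists_pow_mem {H : Subgroup (M ≃ₜ M)} (hH : IsDiscreteConvGroup H)
    {g : M ≃ₜ M} (hgH : g ∈ H) (hg : IsParabolicElem g) {p : M} (hp : g p = p) {x : M}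
    (hx : x ≠ p) {s : ℕ → ℤ} (hs : Function.Injective s) {O : Set M} (hO : O ∈ 𝓝 p) :
    ∃ n, (g ^ s n) x ∈ O := by
  obtain ⟨φ, hφ, a, b, hab⟩ := hH (fun n => g ^ s n) (fun n => H.zpow_mem hgH _)
    (hg.injective_zpow.comp hs)
  have hu : ∀ y, g y = y → y = p := fun y hy => hg.2.unique hy hp
  have h1 : IsConvSeq ((fun n => g ^ s n) ∘ φ) (g a) (g b) := by
    have h := (hab.mul_left g).mul_right g⁻¹
    simp only [inv_inv] at h
    refine h.congr_eventually (Eventually.of_forall fun k => ?_)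
    simp only [Function.comp]
    rw [(Commute.self_zpow g (s (φ k))).eq, mul_inv_cancel_right]
  have ha := hu _ (h1.unique_left hab)
  have hb := hu _ (h1.unique_right hab)
  subst ha
  rw [hb] at hab
  obtain ⟨k, hk⟩ := ((hab.tendsto_apply hx).eventually_mem hO).exists
  exact ⟨_, hk⟩

lemma not_conv_conj_parabolic {f : ℕ → M ≃ₜ M} {σ : M ≃ₜ M} {a e p x : M} (hae : a ≠ e)
    (hfp : Tendsto (fun k => f k p) atTop (𝓝 a)) (hfx : Tendsto (fun k => f k x) atTop (𝓝 e))
    (hσ : ∀ O ∈ 𝓝 p, ∃ n : ℕ, (σ ^ (-(n : ℤ))) x ∈ O)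
    (h : IsConvSeq (fun k => f k * σ * (f k)⁻¹) a e) : False := by
  obtain ⟨V, hV, hVc, hVs⟩ := exists_mem_nhds_isClosed_subset (isOpen_ne.mem_nhds hae)
  have heV : e ∉ V := fun h => hVs h rfl
  have hiV : interior V ∈ 𝓝 a := isOpen_interior.mem_nhds (mem_interior_iff_mem_nhds.2 hV)
  obtain ⟨k, ⟨h1, h2⟩, h3⟩ := ((h.eventually_closed hVc heV hiV).and
    (hfp.eventually_mem hiV) |>.and (hfx.eventually_mem (hVc.isOpen_compl.mem_nhds heV))).exists
  obtain ⟨n, hn⟩ := hσ (f k ⁻¹' interior V)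
    ((isOpen_interior.preimage (f k).continuous).mem_nhds h2)
  have step : ∀ m : ℕ, f k ((σ ^ (-(m : ℤ))) x) ∉ V := fun m => by
    induction m with
    | zero => simpa using h3
    | succ m ih =>
      intro hcon
      apply ih
      have := interior_subset (h1 _ hcon)
      have hpow : σ * σ ^ (-((m + 1 : ℕ) : ℤ)) = σ ^ (-(m : ℤ)) := by
        rw [← zpow_one_add]; congr 1; push_cast; ring
      rw [← hpow]
      simpa only [homeo_mul_apply, homeo_inv_apply_self] using this
  exact step n (interior_subset hn)

/-- Images of a parabolic fixed point under a convergence sequence tend to the attracting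
point, even if the parabolic point is the repelling point. -/
lemma IsConvSeq.tendsto_parabolicPt {H : Subgroup (M ≃ₜ M)} (hH : IsDiscreteConvGroup H) {p : M}
    (hp : IsParabolicPt H p) {f : ℕ → M ≃ₜ M} (hf : ∀ k, f k ∈ H) {e ρ : M}
    (hc : IsConvSeq f e ρ) : Tendsto (fun k => f k p) atTop (𝓝 e) := by
  obtain ⟨g, hgH, hg, hgp⟩ := hp
  have hu : ∀ y, g y = y → y = p := fun y hy => hg.2.unique hy hgp
  refine tendsto_of_subseq_tendsto fun ns hns => ?_
  obtain ⟨a, φ, hφ, ha⟩ := CompactSpace.tendsto_subseq fun k => f (ns k) p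
  refine ⟨φ, ?_⟩
  suffices hae : a = e by rwa [← hae]
  by_contra hae
  set F : ℕ → M ≃ₜ M := fun k => f (ns (φ k)) with hF
  have hFH : ∀ k, F k ∈ H := fun k => hf _
  have hFc : IsConvSeq F e ρ := hc.comp_tendsto (hns.comp hφ.tendsto_atTop)
  have hρ : ρ = p := by
    by_contra hne
    exact hae (tendsto_nhds_unique ha (hFc.tendsto_apply (Ne.symm hne)))
  subst hρ
  obtain ⟨x, hx, -⟩ := exists_ne_ne ρ ρ
  have hgx : g x ≠ ρ := fun h => hx (g.injective (h.trans hgp.symm))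
  obtain ⟨ψ, hψ, hcase⟩ := exists_subseq_const_or_injective fun k => F k * g * (F k)⁻¹
  have hFψ := hFc.subseq hψ
  have haψ : Tendsto (fun k => F (ψ k) ρ) atTop (𝓝 a) := ha.comp hψ.tendsto_atTop
  have hex := hFψ.tendsto_apply hx
  have hegx := hFψ.tendsto_apply hgx
  rcases hcase with hcase | hcase
  · have hact : ∀ k y, (F (ψ 0) * g * (F (ψ 0))⁻¹) (F (ψ k) y) = F (ψ k) (g y) := fun k y => by
      rw [← hcase k]; simp
    have fixed : ∀ y, (F (ψ 0) * g * (F (ψ 0))⁻¹) y = y → y = F (ψ 0) ρ := fun y hy =>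
      homeo_apply_eq_of_inv (hu _ (homeo_eq_inv_apply hy))
    have h1 : (F (ψ 0) * g * (F (ψ 0))⁻¹) a = a := by
      have := ((F (ψ 0) * g * (F (ψ 0))⁻¹).continuous.tendsto a).comp haψ
      refine tendsto_nhds_unique this (haψ.congr fun k => ?_)
      simp only [Function.comp]
      rw [hact, hgp]
    have h2 : (F (ψ 0) * g * (F (ψ 0))⁻¹) e = e := by
      have := ((F (ψ 0) * g * (F (ψ 0))⁻¹).continuous.tendsto e).comp hex
      refine tendsto_nhds_unique this (hegx.congr fun k => ?_)
      simp only [Function.comp]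
      rw [hact]
    exact hae ((fixed a h1).trans (fixed e h2).symm)
  · obtain ⟨χ, hχ, zp, zm, hz⟩ := hH _
      (fun k => H.mul_mem (H.mul_mem (hFH (ψ k)) hgH) (H.inv_mem (hFH (ψ k)))) hcase
    have haχ := haψ.comp hχ.tendsto_atTop
    have heχ := hex.comp hχ.tendsto_atTop
    have hegχ := hegx.comp hχ.tendsto_atTop
    have h1 : a ≠ zm → zp = a := fun hne => by
      refine tendsto_nhds_unique (hz.tendsto haχ hne) (haχ.congr fun k => ?_)
      simp [hgp]
    have h2 : e ≠ zm → zp = e := fun hne => by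
      refine tendsto_nhds_unique (hz.tendsto heχ hne) (hegχ.congr fun k => ?_)
      simp
    by_cases hazm : a = zm
    · have hze : zp = e := h2 (fun h => hae (hazm.trans h.symm))
      have hz' := hz.inv
      rw [hze, ← hazm] at hz'
      refine not_conv_conj_parabolic (f := fun k => F (ψ (χ k))) (σ := g⁻¹) hae haχ heχ
        (fun O hO => ?_) (hz'.congr_eventually (Eventually.of_forall fun k => ?_))
      · obtain ⟨n, hn⟩ := hg.exists_pow_mem hH hgH hgp hx (s := fun n : ℕ => (n : ℤ))
          Nat.cast_injective hO
        exact ⟨n, by simpa using hn⟩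
      · simp [mul_assoc]
    · have hza := h1 hazm
      have hem : e = zm := by
        by_contra hne
        exact hae (hza.symm.trans (h2 hne))
      rw [hza, ← hem] at hz
      refine not_conv_conj_parabolic (f := fun k => F (ψ (χ k))) (σ := g) hae haχ heχ
        (fun O hO => ?_) hz
      obtain ⟨n, hn⟩ := hg.exists_pow_mem hH hgH hgp hx (s := fun n : ℕ => -(n : ℤ))
        (fun m n h => by simpa using h) hO
      exact ⟨n, hn⟩

lemma IsConvSeq.eq_of_stabilizes_parabolicPt {H : Subgroup (M ≃ₜ M)}
    (hH : IsDiscreteConvGroup H) {p : M} (hp : IsParabolicPt H p) {f : ℕ → M ≃ₜ M}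
    (hf : ∀ k, f k ∈ H) (hfp : ∀ k, f k p = p) {e ρ : M} (hc : IsConvSeq f e ρ) :
    e = p ∧ ρ = p := by
  have h1 := hc.tendsto_parabolicPt hH hp hf
  have h2 := hc.inv.tendsto_parabolicPt hH hp (fun k => H.inv_mem (hf k))
  simp only [hfp] at h1
  simp only [fun k => homeo_inv_apply_eq (hfp k)] at h2
  exact ⟨tendsto_nhds_unique h1 tendsto_const_nhds, tendsto_nhds_unique h2 tendsto_const_nhds⟩

lemma IsParabolicPt.not_isConicalLimitPt {H : Subgroup (M ≃ₜ M)} (hH : IsDiscreteConvGroup H)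
    {p : M} (hp : IsParabolicPt H p) : ¬ IsConicalLimitPt H p := fun h => by
  obtain ⟨f, hf, -, a, b, hab, hb, ha⟩ := exists_conicalSeq hH h
  exact hab (tendsto_nhds_unique ha (hb.tendsto_parabolicPt hH hp hf))

lemma toCM_injective : Function.Injective (toCM (M := M)) := fun _ _ hgh =>
  Homeomorph.ext fun x => congrArg (fun F : C(M, M) => F x) hgh

lemma IsConvSeq.not_tendstoHomeo {g : ℕ → M ≃ₜ M} {a b : M} (h : IsConvSeq g a b) :
    ¬ TendstoHomeo g := by
  rintro ⟨f, hf⟩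
  have key : ∀ x, x ≠ b → f x = a := fun x hx => by
    have h1 : Tendsto (fun k => toCM (g k) x) atTop (𝓝 (toCM f x)) :=
      ((continuous_eval_const x).tendsto _).comp hf
    exact tendsto_nhds_unique h1 (h.tendsto_apply hx)
  obtain ⟨x, hx, -⟩ := exists_ne_ne b b
  obtain ⟨y, hy, hyx⟩ := exists_ne_ne b x
  exact hyx (f.injective ((key y hy).trans (key x hx).symm))

lemma IsDiscreteConvGroup.countable {H : Subgroup (M ≃ₜ M)} (hH : IsDiscreteConvGroup H) :
    (H : Set (M ≃ₜ M)).Countable := by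
  let S : Set C(M, M) := toCM '' (H : Set (M ≃ₜ M))
  suffices hS : DiscreteTopology S by
    have : Countable S := TopologicalSpace.separableSpace_iff_countable.1 inferInstance
    exact Set.countable_of_injective_of_countable_image toCM_injective.injOn
      (Set.countable_coe_iff.1 this)
  by_contra hnd
  rw [discreteTopology_iff_isOpen_singleton] at hnd
  push Not at hnd
  obtain ⟨⟨_, f, hf, rfl⟩, hs⟩ := hnd
  set s : S := ⟨toCM f, f, hf, rfl⟩ with hsdef
  have hne : (𝓝[≠] s).NeBot := by
    rw [isOpen_singleton_iff_punctured_nhds] at hs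
    exact ⟨hs⟩
  obtain ⟨U, hU⟩ := (𝓝 s).exists_antitone_basis
  obtain ⟨u, hu, hum⟩ := exists_injective_of_infinite (fun n => infinite_of_mem_nhds s (hU.mem n))
  have hconv : Tendsto u atTop (𝓝 s) := hU.tendsto hum
  choose g hg hgu using fun n => (u n).2
  have hgi : Function.Injective g := fun m n hmn => hu (Subtype.ext (by
    rw [← hgu m, ← hgu n, hmn]))
  obtain ⟨φ, hφ, a, b, hab⟩ := hH g hg hgi
  refine hab.not_tendstoHomeo ⟨f, ?_⟩
  have h1 : Tendsto (fun n => (u n : C(M, M))) atTop (𝓝 (toCM f)) :=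
    (continuous_subtype_val.tendsto s).comp hconv
  simp only [← hgu] at h1
  exact h1.comp hφ.tendsto_atTop

end Groups

section Chains

lemma exists_weights {ι : Type*} [Countable ι] (a : ℕ → ι → ENNReal) (ha : ∀ l t, a l t ≠ ⊤) :
    ∃ w : ι → ENNReal, (∀ t, w t ≠ 0) ∧ ∀ l, ∑' t, w t * a l t ≠ ⊤ := by
  classical
  obtain ⟨e, he⟩ := Countable.exists_injective_nat ι
  obtain ⟨ε, hε, hs⟩ := ENNReal.exists_pos_sum_of_countable (ε := 1) one_ne_zero ι
  have hS : ∀ t, (1 + ∑ l ∈ Finset.range (e t + 1), a l t) ≠ ⊤ := fun t =>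
    ENNReal.add_ne_top.2 ⟨ENNReal.one_ne_top, ENNReal.sum_ne_top.2 fun l _ => ha l t⟩
  have hS0 : ∀ t, (1 + ∑ l ∈ Finset.range (e t + 1), a l t) ≠ 0 := fun t => by simp
  refine ⟨fun t => ε t / (1 + ∑ l ∈ Finset.range (e t + 1), a l t), fun t => ?_, fun l => ?_⟩
  · simp [ENNReal.div_eq_zero_iff, (hε t).ne', hS t]
  · have hw : ∀ t, ε t / (1 + ∑ l ∈ Finset.range (e t + 1), a l t) ≠ ⊤ := fun t =>
      ENNReal.div_ne_top ENNReal.coe_ne_top (hS0 t)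
    let F : Finset ι := (Finset.range l).preimage e he.injOn
    have hle : ∀ t, ε t / (1 + ∑ l ∈ Finset.range (e t + 1), a l t) * a l t ≤ ε t +
        if t ∈ F then ε t / (1 + ∑ l ∈ Finset.range (e t + 1), a l t) * a l t else 0 := fun t => by
      split_ifs with h
      · exact le_add_self
      · have hl : l ∈ Finset.range (e t + 1) := by
          simp only [F, Finset.mem_preimage, Finset.mem_range, not_lt] at h ⊢
          omega
        have h1 : a l t ≤ 1 + ∑ l ∈ Finset.range (e t + 1), a l t :=
          (Finset.single_le_sum (f := fun l => a l t) (fun _ _ => zero_le) hl).trans le_add_self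
        rw [add_zero]
        calc _ ≤ ε t / (1 + ∑ l ∈ Finset.range (e t + 1), a l t) *
              (1 + ∑ l ∈ Finset.range (e t + 1), a l t) := by gcongr
          _ = ε t := ENNReal.div_mul_cancel (hS0 t) (hS t)
    refine ne_top_of_le_ne_top ?_ (ENNReal.tsum_le_tsum hle)
    rw [ENNReal.tsum_add]
    refine ENNReal.add_ne_top.2 ⟨(hs.trans ENNReal.one_lt_top).ne, ?_⟩
    rw [tsum_eq_sum (s := F) (fun t ht => by simp [ht])]
    refine ENNReal.sum_ne_top.2 fun t ht => ?_
    rw [if_pos ht]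
    exact ENNReal.mul_ne_top (hw t) (ha l t)

/-- At least two of the three points `f (q i)` lie in `X`. -/
def Maj (q : Fin 3 → M) (f : M ≃ₜ M) (X : Set M) : Prop :=
  ∃ a b : Fin 3, a ≠ b ∧ f (q a) ∈ X ∧ f (q b) ∈ X

lemma Maj.inter_nonempty {q : Fin 3 → M} {f : M ≃ₜ M} {X Y : Set M} (hX : Maj q f X)
    (hY : Maj q f Y) : (X ∩ Y).Nonempty := by
  obtain ⟨a, b, hab, h1, h2⟩ := hX
  obtain ⟨c, d, hcd, h3, h4⟩ := hY
  have : a = c ∨ a = d ∨ b = c ∨ b = d := by omega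
  rcases this with rfl | rfl | rfl | rfl
  · exact ⟨_, h1, h3⟩
  · exact ⟨_, h1, h4⟩
  · exact ⟨_, h2, h3⟩
  · exact ⟨_, h2, h4⟩

lemma Maj.mono {q : Fin 3 → M} {f : M ≃ₜ M} {X Y : Set M} (hX : Maj q f X)
    (h : X ⊆ Y) : Maj q f Y := by
  obtain ⟨a, b, hab, h1, h2⟩ := hX
  exact ⟨a, b, hab, h h1, h h2⟩

lemma exists_ne_indices {q : Fin 3 → M} (hq : Function.Injective q) (ρ : M) :
    ∃ a b : Fin 3, a ≠ b ∧ q a ≠ ρ ∧ q b ≠ ρ := by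
  by_cases h0 : q 0 = ρ
  · refine ⟨1, 2, by decide, fun h => ?_, fun h => ?_⟩
    · exact absurd (hq (h.trans h0.symm)) (by decide)
    · exact absurd (hq (h.trans h0.symm)) (by decide)
  · by_cases h1 : q 1 = ρ
    · exact ⟨0, 2, by decide, h0, fun h => absurd (hq (h.trans h1.symm)) (by decide)⟩
    · exact ⟨0, 1, by decide, h0, h1⟩

section MajConvergence

variable [CompactSpace M] [TopologicalSpace.MetrizableSpace M]

lemma IsConvSeq.eventually_maj {q : Fin 3 → M} (hq : Function.Injective q) {f : ℕ → M ≃ₜ M}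
    {x ρ : M} (h : IsConvSeq f x ρ) {X : Set M} (hX : X ∈ 𝓝 x) :
    ∀ᶠ k in atTop, Maj q (f k) X := by
  obtain ⟨a, b, hab, h1, h2⟩ := exists_ne_indices hq ρ
  filter_upwards [(h.tendsto_apply h1).eventually_mem hX, (h.tendsto_apply h2).eventually_mem hX]
    with k h3 h4 using ⟨a, b, hab, h3, h4⟩

end MajConvergence

/-- Indices `(g, n)` of annuli `g⁻¹ Q n ∖ g⁻¹ P n`, `g ∈ J`, whose inner part meets both `V`
and `W` while the base point `o` is outside. -/
def linkedIndices (J : Subgroup (M ≃ₜ M)) (o : M) (P Q : ℕ → Set M) (V W : Set M) :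
    Set ((M ≃ₜ M) × ℕ) :=
  {A | A.1 ∈ J ∧ (∃ v ∈ V, A.1 v ∈ P A.2) ∧ (∃ w ∈ W, A.1 w ∈ P A.2) ∧ A.1 o ∉ Q A.2}

/-- A finite nested family of annuli separating the base point `o` from the majority of
`f (q i)`. -/
def IsAnnulusChain (J : Subgroup (M ≃ₜ M)) (o : M) (q : Fin 3 → M) (P Q : ℕ → Set M)
    (f : M ≃ₜ M) (E : Finset ((M ≃ₜ M) × ℕ)) : Prop :=
  (∀ A ∈ E, A.1 ∈ J ∧ Maj q f (A.1 ⁻¹' P A.2) ∧ A.1 o ∉ Q A.2) ∧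
    ∀ A ∈ E, ∀ B ∈ E, A ≠ B →
      A.1 ⁻¹' Q A.2 ⊆ B.1 ⁻¹' P B.2 ∨ B.1 ⁻¹' Q B.2 ⊆ A.1 ⁻¹' P A.2

lemma isAnnulusChain_empty (J : Subgroup (M ≃ₜ M)) (o : M) (q : Fin 3 → M) (P Q : ℕ → Set M)
    (f : M ≃ₜ M) : IsAnnulusChain J o q P Q f ∅ := by
  simp [IsAnnulusChain]

instance (J : Subgroup (M ≃ₜ M)) (o : M) (q : Fin 3 → M) (P Q : ℕ → Set M) (f : M ≃ₜ M) :
    Nonempty {E // IsAnnulusChain J o q P Q f E} := ⟨⟨∅, isAnnulusChain_empty ..⟩⟩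

/-- The largest number of elements of an annulus chain. -/
noncomputable def chainNumber (J : Subgroup (M ≃ₜ M)) (o : M) (q : Fin 3 → M) (P Q : ℕ → Set M)
    (f : M ≃ₜ M) : ENNReal :=
  ⨆ E : {E // IsAnnulusChain J o q P Q f E}, (E.1.card : ENNReal)

lemma IsAnnulusChain.card_le {J : Subgroup (M ≃ₜ M)} {o : M} {q : Fin 3 → M} {P Q : ℕ → Set M}
    {f : M ≃ₜ M} {E : Finset ((M ≃ₜ M) × ℕ)} (h : IsAnnulusChain J o q P Q f E) :
    (E.card : ENNReal) ≤ chainNumber J o q P Q f :=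
  le_iSup (fun E : {E // IsAnnulusChain J o q P Q f E} => (E.1.card : ENNReal)) ⟨E, h⟩

lemma chainNumber_ne_top {J : Subgroup (M ≃ₜ M)} {o : M} {q : Fin 3 → M} {P Q : ℕ → Set M}
    {f : M ≃ₜ M} (hLF : ∀ a b : Fin 3, a ≠ b → (linkedIndices J o P Q {f (q a)} {f (q b)}).Finite) :
    chainNumber J o q P Q f ≠ ⊤ := by
  classical
  have hfin : (⋃ a : Fin 3, ⋃ b : Fin 3, ⋃ _ : a ≠ b,
      linkedIndices J o P Q {f (q a)} {f (q b)}).Finite :=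
    Set.finite_iUnion fun a => Set.finite_iUnion fun b => Set.finite_iUnion fun h => hLF a b h
  refine ne_top_of_le_ne_top (ENNReal.natCast_ne_top hfin.toFinset.card) (iSup_le ?_)
  rintro ⟨E, hE⟩
  refine Nat.cast_le.2 (Finset.card_le_card fun A hA => ?_)
  obtain ⟨h1, ⟨a, b, hab, h2, h3⟩, h4⟩ := hE.1 A hA
  rw [hfin.mem_toFinset]
  exact Set.mem_iUnion.2 ⟨a, Set.mem_iUnion.2 ⟨b, Set.mem_iUnion.2 ⟨hab, h1, ⟨_, rfl, h2⟩,
    ⟨_, rfl, h3⟩, h4⟩⟩⟩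

/-- A nested family of annuli around `x`. -/
def IsNestAt (J : Subgroup (M ≃ₜ M)) (x o : M) (P Q : ℕ → Set M)
    (E : Finset ((M ≃ₜ M) × ℕ)) : Prop :=
  (∀ A ∈ E, A.1 ∈ J ∧ A.1 ⁻¹' P A.2 ∈ 𝓝 x ∧ A.1 o ∉ Q A.2) ∧
    ∀ A ∈ E, ∀ B ∈ E, A ≠ B →
      A.1 ⁻¹' Q A.2 ⊆ B.1 ⁻¹' P B.2 ∨ B.1 ⁻¹' Q B.2 ⊆ A.1 ⁻¹' P A.2

/-- The translates of the annuli `Q n ∖ P n` by `J` shrink to `x`. -/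
def ShrinksTo (J : Subgroup (M ≃ₜ M)) (x : M) (P Q : ℕ → Set M) : Prop :=
  ∀ O ∈ 𝓝 x, ∃ A : (M ≃ₜ M) × ℕ, A.1 ∈ J ∧ A.1 ⁻¹' P A.2 ∈ 𝓝 x ∧ A.1 ⁻¹' Q A.2 ⊆ O

lemma IsNestAt.exists_inner [T1Space M] {J : Subgroup (M ≃ₜ M)} {x o : M} {P Q : ℕ → Set M}
    {E : Finset ((M ≃ₜ M) × ℕ)} (hE : IsNestAt J x o P Q E) (hx : ¬ IsOpen ({x} : Set M))
    (hxo : o ≠ x) (hPQ : ∀ n, P n ⊆ Q n) :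
    ∃ O ∈ 𝓝 x, o ∉ O ∧ (∀ A ∈ E, O ⊆ A.1 ⁻¹' P A.2) ∧ ∀ A ∈ E, ¬ A.1 ⁻¹' Q A.2 ⊆ O := by
  have h1 : (⋂ A ∈ E, A.1 ⁻¹' P A.2) ∈ 𝓝 x :=
    (Filter.biInter_finset_mem E).2 fun A hA => (hE.1 A hA).2.1
  obtain ⟨y, hy, hyx⟩ := exists_mem_ne_of_not_isOpen hx isOpen_interior
    ⟨x, mem_interior_iff_mem_nhds.2 h1⟩
  refine ⟨(⋂ A ∈ E, A.1 ⁻¹' P A.2) ∩ ({y}ᶜ ∩ {o}ᶜ), inter_mem h1 (inter_mem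
    (isOpen_compl_singleton.mem_nhds hyx.symm) (isOpen_compl_singleton.mem_nhds hxo.symm)),
    fun h => h.2.2 rfl, fun A hA z hz => Set.mem_iInter₂.1 hz.1 A hA, fun A hA hsub => ?_⟩
  exact (hsub (hPQ _ (Set.mem_iInter₂.1 (interior_subset hy) A hA))).2.1 rfl

lemma ShrinksTo.exists_nest [T1Space M] {J : Subgroup (M ≃ₜ M)} {x o : M} {P Q : ℕ → Set M}
    (hS : ShrinksTo J x P Q) (hx : ¬ IsOpen ({x} : Set M)) (hxo : o ≠ x)
    (hPQ : ∀ n, P n ⊆ Q n) (L : ℕ) : ∃ E, IsNestAt J x o P Q E ∧ E.card = L := by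
  classical
  induction L with
  | zero => exact ⟨∅, by simp [IsNestAt], rfl⟩
  | succ L ih =>
    obtain ⟨E, hE, hcard⟩ := ih
    obtain ⟨O, hO, hoO, hsub, hnot⟩ := hE.exists_inner hx hxo hPQ
    obtain ⟨A, hA, hAx, hAO⟩ := hS O hO
    have hAE : A ∉ E := fun h => hnot A h hAO
    refine ⟨insert A E, ⟨?_, ?_⟩, by rw [Finset.card_insert_of_notMem hAE, hcard]⟩
    · intro B hB
      rcases Finset.mem_insert.1 hB with rfl | hB
      · exact ⟨hA, hAx, fun h => hoO (hAO h)⟩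
      · exact hE.1 B hB
    · intro B hB C hC hBC
      rcases Finset.mem_insert.1 hB with rfl | hB'
      · rcases Finset.mem_insert.1 hC with rfl | hC'
        · exact absurd rfl hBC
        · exact Or.inl (hAO.trans (hsub C hC'))
      · rcases Finset.mem_insert.1 hC with rfl | hC'
        · exact Or.inr (hAO.trans (hsub B hB'))
        · exact hE.2 B hB' C hC' hBC

/-- Passing from `s f` to `f`, where `s⁻¹` compresses the complement of `W` into `O`, a chain
loses only boundedly many annuli, and annuli nested around `O` may be added. -/
lemma chainNumber_add_le {J : Subgroup (M ≃ₜ M)} {o : M} {q : Fin 3 → M} {P Q : ℕ → Set M}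
    {V W O : Set M} {f s : M ≃ₜ M} (hs : s ∈ J)
    (hLF : (linkedIndices J o P Q V W).Finite) (hV : Maj q (s * f) V)
    (hW : ∀ y, s y ∉ W → y ∈ O) (hoO : o ∉ O) {E₀ : Finset ((M ≃ₜ M) × ℕ)}
    (hE₀ : IsAnnulusChain J o q P Q f E₀) (hsub : ∀ A ∈ E₀, O ⊆ A.1 ⁻¹' P A.2)
    (hnot : ∀ A ∈ E₀, ¬ A.1 ⁻¹' Q A.2 ⊆ O) :
    chainNumber J o q P Q (s * f) + E₀.card ≤
      chainNumber J o q P Q f + (1 + (hLF.toFinset.card : ENNReal)) := by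
  classical
  rw [chainNumber, ENNReal.iSup_add]
  refine iSup_le ?_
  rintro ⟨E, hE⟩
  change (E.card : ENNReal) + E₀.card ≤ _
  set E₁ := E.filter fun A => (W ∩ A.1 ⁻¹' Q A.2).Nonempty with hE₁
  set E₂ := E.filter fun A => ¬ (W ∩ A.1 ⁻¹' Q A.2).Nonempty with hE₂
  have hsplit : E₁.card + E₂.card = E.card := Finset.card_filter_add_card_filter_not _
  have hE₁card : E₁.card ≤ hLF.toFinset.card + 1 := by
    have h1 : (E₁ \ hLF.toFinset).card ≤ 1 := by
      refine Finset.card_le_one.2 fun A hA B hB => ?_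
      by_contra hAB
      have aux : ∀ A ∈ E₁ \ hLF.toFinset, ∀ B ∈ E₁, ¬ B.1 ⁻¹' Q B.2 ⊆ A.1 ⁻¹' P A.2 := by
        intro A hA B hB hBA
        obtain ⟨hA1, hA2⟩ := Finset.mem_sdiff.1 hA
        apply hA2
        rw [hLF.mem_toFinset]
        have hAE := hE.1 A (Finset.mem_filter.1 hA1).1
        obtain ⟨w, hw1, hw2⟩ := (Finset.mem_filter.1 hB).2
        obtain ⟨v, hv1, hv2⟩ := hV.inter_nonempty hAE.2.1
        exact ⟨hAE.1, ⟨v, hv1, hv2⟩, ⟨w, hw1, hBA hw2⟩, hAE.2.2⟩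
      have hA1 := (Finset.mem_sdiff.1 hA).1
      have hB1 := (Finset.mem_sdiff.1 hB).1
      rcases hE.2 A (Finset.mem_filter.1 hA1).1 B (Finset.mem_filter.1 hB1).1 hAB with h | h
      · exact aux B hB A hA1 h
      · exact aux A hA B hB1 h
    have h2 := Finset.card_le_card_sdiff_add_card (s := E₁) (t := hLF.toFinset)
    omega
  let ψ : (M ≃ₜ M) × ℕ → (M ≃ₜ M) × ℕ := fun A => (A.1 * s, A.2)
  have hψ : Function.Injective ψ := by
    rintro ⟨g, n⟩ ⟨g', n'⟩ h
    simp only [ψ, Prod.mk.injEq] at h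
    rw [mul_right_cancel h.1, h.2]
  have hQO : ∀ A ∈ E₂, (ψ A).1 ⁻¹' Q (ψ A).2 ⊆ O := fun A hA y hy => by
    refine hW y fun hyW => (Finset.mem_filter.1 hA).2 ⟨s y, hyW, hy⟩
  have hdisj : Disjoint (E₂.image ψ) E₀ := by
    rw [Finset.disjoint_left]
    intro B hB hB₀
    obtain ⟨A, hA, rfl⟩ := Finset.mem_image.1 hB
    exact hnot _ hB₀ (hQO A hA)
  have hchain : IsAnnulusChain J o q P Q f (E₂.image ψ ∪ E₀) := by
    refine ⟨fun B hB => ?_, fun B hB C hC hBC => ?_⟩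
    · rcases Finset.mem_union.1 hB with hB | hB
      · obtain ⟨A, hA, rfl⟩ := Finset.mem_image.1 hB
        have hAE := hE.1 A (Finset.mem_filter.1 hA).1
        exact ⟨J.mul_mem hAE.1 hs, hAE.2.1, fun h => hoO (hQO A hA h)⟩
      · exact hE₀.1 B hB
    · rcases Finset.mem_union.1 hB with hB | hB <;> rcases Finset.mem_union.1 hC with hC | hC
      · obtain ⟨A, hA, rfl⟩ := Finset.mem_image.1 hB
        obtain ⟨A', hA', rfl⟩ := Finset.mem_image.1 hC
        exact (hE.2 A (Finset.mem_filter.1 hA).1 A' (Finset.mem_filter.1 hA').1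
          (fun h => hBC (by rw [h]))).imp (fun h y hy => h hy) (fun h y hy => h hy)
      · obtain ⟨A, hA, rfl⟩ := Finset.mem_image.1 hB
        exact Or.inl ((hQO A hA).trans (hsub C hC))
      · obtain ⟨A, hA, rfl⟩ := Finset.mem_image.1 hC
        exact Or.inr ((hQO A hA).trans (hsub B hB))
      · exact hE₀.2 B hB C hC hBC
  have hcard := hchain.card_le
  rw [Finset.card_union_of_disjoint hdisj, Finset.card_image_of_injective _ hψ] at hcard
  calc (E.card : ENNReal) + E₀.card
      ≤ ((E₂.card + E₀.card : ℕ) : ENNReal) + (1 + (hLF.toFinset.card : ENNReal)) := by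
        norm_cast; omega
    _ ≤ _ := by gcongr

variable [CompactSpace M] [TopologicalSpace.MetrizableSpace M]

/-- Each element of a sequence can be adjusted on the left by `J` so that no convergence
subsequence has an attracting point at which annuli of some type shrink and at which `J`
expands uniformly. -/
lemma exists_adjusted_seq {ι : Type*} [Countable ι] (J : Subgroup (M ≃ₜ M)) (o : M)
    {q : Fin 3 → M} (hq : Function.Injective q) {P Q : ι → ℕ → Set M}
    (hPQ : ∀ t n, P t n ⊆ Q t n) (V W : ℕ → Set M)
    (hLF : ∀ t l, (linkedIndices J o (P t) (Q t) (V l) (W l)).Finite) (f : ℕ → M ≃ₜ M)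
    (hf : ∀ t k, chainNumber J o q (P t) (Q t) (f k) ≠ ⊤) :
    ∃ j : ℕ → M ≃ₜ M, (∀ k, j k ∈ J) ∧ ∀ φ : ℕ → ℕ, ∀ x ρ : M,
      IsConvSeq (fun k => j (φ k) * f (φ k)) x ρ → ¬ IsOpen ({x} : Set M) → o ≠ x →
      ∀ t, ShrinksTo J x (P t) (Q t) → ¬ ∃ l, ∀ O ∈ 𝓝 x, ∃ᶠ k in atTop, ∃ s ∈ J,
        Maj q (s * (j (φ k) * f (φ k))) (V l) ∧ ∀ y, s y ∉ W l → y ∈ O := by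
  classical
  let c : ℕ → ι → ENNReal := fun l t => 1 + ((hLF t l).toFinset.card : ENNReal)
  have hc : ∀ l t, c l t ≠ ⊤ := fun l t =>
    ENNReal.add_ne_top.2 ⟨ENNReal.one_ne_top, ENNReal.natCast_ne_top _⟩
  obtain ⟨w, hw0, hw⟩ := exists_weights
    (fun n t => c n t + chainNumber J o q (P t) (Q t) (f n))
    (fun n t => ENNReal.add_ne_top.2 ⟨hc n t, hf t n⟩)
  let N : (M ≃ₜ M) → ENNReal := fun g => ∑' t, w t * chainNumber J o q (P t) (Q t) g
  have hNf : ∀ k, N (f k) ≠ ⊤ := fun k =>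
    ne_top_of_le_ne_top (hw k) (ENNReal.tsum_le_tsum fun t => by gcongr; exact le_add_self)
  have hcw : ∀ l, ∑' t, w t * c l t ≠ ⊤ := fun l =>
    ne_top_of_le_ne_top (hw l) (ENNReal.tsum_le_tsum fun t => by gcongr; exact le_self_add)
  have hj : ∀ k, ∃ j ∈ J, ∀ s ∈ J, N (j * f k) ≤ N (s * f k) + 1 := fun k => by
    have hle : (⨅ s : J, N (s * f k)) ≤ N (f k) :=
      (iInf_le (fun s : J => N (s * f k)) 1).trans_eq (by simp)
    have hlt : (⨅ s : J, N (s * f k)) < (⨅ s : J, N (s * f k)) + 1 :=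
      ENNReal.lt_add_right (ne_top_of_le_ne_top (hNf k) hle) one_ne_zero
    obtain ⟨j, hj⟩ := iInf_lt_iff.1 hlt
    exact ⟨j, j.2, fun s hs => hj.le.trans (by
      gcongr; exact iInf_le (fun s : J => N (s * f k)) ⟨s, hs⟩)⟩
  choose j hjJ hjN using hj
  refine ⟨j, hjJ, fun φ x ρ hconv hx hxo t₀ hS ⟨l, hl⟩ => ?_⟩
  have hNF : ∀ k, N (j k * f k) ≠ ⊤ := fun k => by
    refine ne_top_of_le_ne_top (ENNReal.add_ne_top.2 ⟨hNf k, ENNReal.one_ne_top⟩)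
      ((hjN k 1 J.one_mem).trans_eq (by simp))
  have hbound : ∀ L : ℕ, w t₀ * L ≤ 1 + ∑' t, w t * c l t := fun L => by
    obtain ⟨E₀, hE₀, hcard⟩ := hS.exists_nest hx hxo (hPQ t₀) L
    obtain ⟨O, hO, hoO, hsub, hnot⟩ := hE₀.exists_inner hx hxo (hPQ t₀)
    have hmaj : ∀ᶠ k in atTop, ∀ A ∈ E₀, Maj q (j (φ k) * f (φ k)) (A.1 ⁻¹' P t₀ A.2) :=
      (Filter.eventually_all_finset E₀).2 fun A hA => hconv.eventually_maj hq (hE₀.1 A hA).2.1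
    obtain ⟨k, ⟨s, hs, hsV, hsW⟩, hk⟩ := ((hl O hO).and_eventually hmaj).exists
    set F := j (φ k) * f (φ k) with hF
    have hterm : ∀ t, w t * chainNumber J o q (P t) (Q t) (s * F) +
        (if t = t₀ then w t₀ * L else 0) ≤
        w t * chainNumber J o q (P t) (Q t) F + w t * c l t := fun t => by
      split_ifs with h
      · subst h
        rw [← mul_add, ← mul_add]
        refine mul_le_mul' le_rfl ?_
        have := chainNumber_add_le hs (hLF t l) hsV hsW hoO
          ⟨fun A hA => ⟨(hE₀.1 A hA).1, hk A hA, (hE₀.1 A hA).2.2⟩, hE₀.2⟩ hsub hnot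
        rwa [hcard] at this
      · rw [add_zero, ← mul_add]
        gcongr
        have := chainNumber_add_le hs (hLF t l) hsV hsW hoO
          (isAnnulusChain_empty J o q (P t) (Q t) F) (by simp) (by simp)
        simpa using this
    have hsum : N (s * F) + w t₀ * L ≤ N F + ∑' t, w t * c l t := by
      have := ENNReal.tsum_le_tsum hterm
      rw [ENNReal.tsum_add, ENNReal.tsum_add, tsum_ite_eq] at this
      exact this
    have hNs : N (s * F) ≠ ⊤ := by
      refine ne_top_of_le_ne_top (ENNReal.add_ne_top.2 ⟨hNF (φ k), hcw l⟩)
        (le_self_add.trans hsum)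
    have hle : N F ≤ N (s * F) + 1 := by
      have := hjN (φ k) (s * j (φ k)) (J.mul_mem hs (hjJ _))
      rwa [mul_assoc] at this
    have : N (s * F) + w t₀ * L ≤ N (s * F) + (1 + ∑' t, w t * c l t) := by
      rw [← add_assoc]
      exact hsum.trans (by gcongr)
    exact (ENNReal.add_le_add_iff_left hNs).1 this
  have hfin : (1 + ∑' t, w t * c l t) ≠ ⊤ := ENNReal.add_ne_top.2 ⟨ENNReal.one_ne_top, hcw l⟩
  obtain ⟨L, hL⟩ := ENNReal.exists_nat_mul_gt (hw0 t₀) hfin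
  rw [mul_comm] at hL
  exact absurd (hbound L) (not_le.2 hL)

end Chains

section Cosets

variable [CompactSpace M] [TopologicalSpace.MetrizableSpace M]

lemma exists_separating_pairs : ∃ V W : ℕ → Set M, (∀ l, IsClosed (V l)) ∧
    (∀ l, IsClosed (W l)) ∧ (∀ l, Disjoint (V l) (W l)) ∧
    ∀ a b : M, a ≠ b → ∃ l, V l ∈ 𝓝 a ∧ W l ∈ 𝓝 b := by
  let 𝓑 := TopologicalSpace.countableBasis M
  have h𝓑 : TopologicalSpace.IsTopologicalBasis 𝓑 := TopologicalSpace.isBasis_countableBasis M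
  let S : Set (Set M × Set M) :=
    insert (∅, ∅) {p | p ∈ 𝓑 ×ˢ 𝓑 ∧ Disjoint (closure p.1) (closure p.2)}
  have hS : S.Countable := (((TopologicalSpace.countable_countableBasis M).prod
    (TopologicalSpace.countable_countableBasis M)).mono fun p hp => hp.1).insert _
  obtain ⟨e, he⟩ := hS.exists_eq_range ⟨_, mem_insert _ _⟩
  have hdisj : ∀ p ∈ S, Disjoint (closure p.1) (closure p.2) := by
    rintro p (rfl | hp)
    · simp
    · exact hp.2
  refine ⟨fun l => closure (e l).1, fun l => closure (e l).2, fun _ => isClosed_closure,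
    fun _ => isClosed_closure, fun l => hdisj _ (he ▸ mem_range_self l), fun a b hab => ?_⟩
  obtain ⟨u, ha, hu, v, hb, hv, huv⟩ := exists_open_nhds_disjoint_closure hab
  obtain ⟨u', hu', hau', huu'⟩ := h𝓑.exists_subset_of_mem_open ha hu
  obtain ⟨v', hv', hbv', hvv'⟩ := h𝓑.exists_subset_of_mem_open hb hv
  have hmem : (u', v') ∈ S := Or.inr ⟨⟨hu', hv'⟩,
    huv.mono (closure_mono huu') (closure_mono hvv')⟩
  rw [he] at hmem
  obtain ⟨l, hl⟩ := hmem
  refine ⟨l, ?_, ?_⟩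
  · simp only [hl]; exact mem_of_superset ((h𝓑.isOpen hu').mem_nhds hau') subset_closure
  · simp only [hl]; exact mem_of_superset ((h𝓑.isOpen hv').mem_nhds hbv') subset_closure

variable [Infinite M]

lemma finite_linkedIndices_fst {J : Subgroup (M ≃ₜ M)} (hJ : IsDiscreteConvGroup J) {o : M}
    (ho : o ∉ limitSet J) {P Q : ℕ → Set M} {n : ℕ} (hQ : IsOpen (Q n))
    (hPQ : closure (P n) ⊆ Q n) {V W : Set M} (hV : IsClosed V) (hW : IsClosed W)
    (hVW : Disjoint V W) : {A ∈ linkedIndices J o P Q V W | A.2 = n}.Finite := by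
  by_contra hinf
  obtain ⟨A, hA, hAm⟩ := exists_injective_of_infinite (fun _ : ℕ => hinf)
  have hgi : Function.Injective fun k => (A k).1 := fun k l hkl =>
    hA (Prod.ext hkl ((hAm k).2.trans (hAm l).2.symm))
  obtain ⟨φ, hφ, ζ, ζ', hc⟩ := hJ (fun k => (A k).1) (fun k => (hAm k).1.1) hgi
  have hζ' : ζ' ∈ limitSet J :=
    hc.mem_limitSet_right (fun k => (hAm (φ k)).1.1) (hgi.comp hφ.injective)
  have hoζ : o ≠ ζ' := fun h => ho (h ▸ hζ')
  have hζQ : ζ ∉ Q n := by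
    refine hQ.isClosed_compl.mem_of_tendsto (hc.tendsto_apply hoζ)
      (Eventually.of_forall fun k => ?_)
    have := (hAm (φ k)).1.2.2.2
    rwa [(hAm (φ k)).2] at this
  have hnhd : (closure (P n))ᶜ ∈ 𝓝 ζ :=
    isClosed_closure.isOpen_compl.mem_nhds fun h => hζQ (hPQ h)
  have key : ∀ S : Set M, IsClosed S → ζ' ∉ S → ¬ ∀ k, ∃ v ∈ S, (A k).1 v ∈ P (A k).2 := by
    intro S hS hζS hex
    obtain ⟨k, hk⟩ := (hc.eventually_closed hS hζS hnhd).exists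
    obtain ⟨v, hv, hvP⟩ := hex (φ k)
    rw [(hAm (φ k)).2] at hvP
    exact hk v hv (subset_closure hvP)
  by_cases hζV : ζ' ∈ V
  · exact key W hW (fun h => hVW.le_bot ⟨hζV, h⟩) fun k => (hAm k).1.2.2.1
  · exact key V hV hζV fun k => (hAm k).1.2.1

/-- The bounded parabolicity of `p` relative to a larger limit set `L`. -/
def IsRelBoundedParabolic (J : Subgroup (M ≃ₜ M)) (L : Set M) (p : M) : Prop :=
  IsParabolicPt J p ∧ ∃ K : Set M, IsCompact K ∧ p ∉ K ∧
    ∀ x ∈ L, x ≠ p → ∃ h ∈ J, h p = p ∧ h x ∈ K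

lemma exists_next_shell {J : Subgroup (M ≃ₜ M)} (hJ : IsDiscreteConvGroup J) {p : M}
    (hp : IsParabolicPt J p) {O U : Set M} (hO : O ∈ 𝓝 p) (hU : U ∈ 𝓝 p) :
    ∃ O', IsOpen O' ∧ p ∈ O' ∧ closure O' ⊆ O ∧ O' ⊆ U ∧
      ∀ h ∈ J, h p = p → (∃ y, y ∉ U ∧ h y ∈ O') → ∀ y, y ∉ U → h y ∈ O := by
  let Bad : Set (M ≃ₜ M) := {h | h ∈ J ∧ h p = p ∧ ¬ ∀ y, y ∉ U → h y ∈ O}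
  have hBad : Bad.Finite := by
    by_contra hinf
    obtain ⟨h, hi, hm⟩ := exists_injective_of_infinite (fun _ : ℕ => hinf)
    obtain ⟨φ, hφ, a, b, hc⟩ := hJ h (fun k => (hm k).1) hi
    obtain ⟨rfl, rfl⟩ := hc.eq_of_stabilizes_parabolicPt hJ hp (fun k => (hm _).1)
      (fun k => (hm _).2.1)
    obtain ⟨k, hk⟩ := (hc.eventually_closed (K := (interior U)ᶜ) isOpen_interior.isClosed_compl
      (by simpa using mem_interior_iff_mem_nhds.2 hU) hO).exists
    exact (hm (φ k)).2.2 fun y hy => hk y fun h => hy (interior_subset h)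
  have hN : (O ∩ U) ∩ ⋂ h ∈ Bad, (h '' (interior U)ᶜ)ᶜ ∈ 𝓝 p := by
    refine inter_mem (inter_mem hO hU) ((Filter.biInter_mem hBad).2 fun h hh => ?_)
    refine (h.isClosedMap _ isOpen_interior.isClosed_compl).isOpen_compl.mem_nhds ?_
    rintro ⟨y, hy, hyp⟩
    have : y = p := h.injective (hyp.trans hh.2.1.symm)
    exact hy (this ▸ mem_interior_iff_mem_nhds.2 hU)
  obtain ⟨Z, hZ, hZc, hZs⟩ := exists_mem_nhds_isClosed_subset hN
  have hcl : closure (interior Z) ⊆ Z := hZc.closure_subset_iff.2 interior_subset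
  refine ⟨interior Z, isOpen_interior, mem_interior_iff_mem_nhds.2 hZ,
    fun y hy => (hZs (hcl hy)).1.1, fun y hy => (hZs (interior_subset hy)).1.2, ?_⟩
  rintro h hJh hhp ⟨y, hyU, hyZ⟩
  by_contra hbad
  have := Set.mem_iInter₂.1 (hZs (interior_subset hyZ)).2 h ⟨hJh, hhp, hbad⟩
  exact this ⟨y, fun h => hyU (interior_subset h), rfl⟩

/-- Around a parabolic point there are nested neighbourhoods which are separated from each
other even modulo the stabilizer. -/
lemma exists_shells {J : Subgroup (M ≃ₜ M)} (hJ : IsDiscreteConvGroup J) {p : M}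
    (hp : IsParabolicPt J p) : ∃ U : ℕ → Set M, (𝓝 p).HasAntitoneBasis U ∧ ∃ O : ℕ → Set M,
      (∀ n, IsOpen (O n)) ∧ (∀ n, p ∈ O n) ∧ (∀ n, closure (O (n + 1)) ⊆ O n) ∧
      (∀ n, O (n + 1) ⊆ U n) ∧ ∀ n, ∀ h ∈ J, h p = p → (∃ y, y ∉ U n ∧ h y ∈ O (n + 1)) →
        ∀ y, y ∉ U n → h y ∈ O n := by
  obtain ⟨U, hU⟩ := (𝓝 p).exists_antitone_basis
  choose F hF using fun (n : ℕ) (O : {O : Set M // IsOpen O ∧ p ∈ O}) =>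
    exists_next_shell hJ hp (O.2.1.mem_nhds O.2.2) (hU.mem n)
  let O : ℕ → {O : Set M // IsOpen O ∧ p ∈ O} := fun n =>
    Nat.rec ⟨univ, isOpen_univ, mem_univ p⟩ (fun n O => ⟨F n O, (hF n O).1, (hF n O).2.1⟩) n
  have hO : ∀ n, (O (n + 1) : Set M) = F n (O n) := fun n => rfl
  refine ⟨U, hU, fun n => (O n).1, fun n => (O n).2.1, fun n => (O n).2.2, fun n => ?_, fun n => ?_,
    fun n => ?_⟩
  · simp only [hO]; exact (hF n (O n)).2.2.1
  · simp only [hO]; exact (hF n (O n)).2.2.2.1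
  · simp only [hO]; exact (hF n (O n)).2.2.2.2

lemma finite_linkedIndices_shells {H J : Subgroup (M ≃ₜ M)} (hJH : J ≤ H)
    (hJ : IsDiscreteConvGroup J) {p o : M} (hpJ : p ∈ limitSet J)
    (hp : IsRelBoundedParabolic J (limitSet H) p) (hoH : o ∈ limitSet H) (ho : o ∉ limitSet J)
    {U O : ℕ → Set M} (hU : (𝓝 p).HasAntitoneBasis U) (hO : ∀ n, IsOpen (O n))
    (hcl : ∀ n, closure (O (n + 1)) ⊆ O n)
    (hsh : ∀ n, ∀ h ∈ J, h p = p → (∃ y, y ∉ U n ∧ h y ∈ O (n + 1)) → ∀ y, y ∉ U n → h y ∈ O n)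
    {V W : Set M} (hV : IsClosed V) (hW : IsClosed W) (hVW : Disjoint V W) :
    (linkedIndices J o (fun n => O (n + 1)) O V W).Finite := by
  by_contra hinf
  obtain ⟨A, hA, hAm⟩ := exists_injective_of_infinite (fun _ : ℕ => hinf)
  obtain ⟨φ, hφ, hcase⟩ := exists_subseq_const_or_injective fun k => (A k).2
  rcases hcase with hcase | hcase
  · refine absurd (finite_linkedIndices_fst hJ ho (n := (A (φ 0)).2) (P := fun n => O (n + 1))
      (hO _) (hcl _) hV hW hVW) (Set.Infinite.mono ?_ (Set.infinite_range_of_injective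
        (hA.comp hφ.injective)))
    rintro _ ⟨k, rfl⟩
    exact ⟨hAm _, hcase k⟩
  obtain ⟨-, K, hK, hpK, hcov⟩ := hp
  have hgo : ∀ k, (A (φ k)).1 o ≠ p := fun k h => ho (by
    rw [← h] at hpJ
    exact (apply_mem_limitSet_iff (hAm (φ k)).1).1 hpJ)
  choose h hhJ hhp hhK using fun k => hcov _
    (apply_mem_limitSet hoH (hJH (hAm (φ k)).1)) (hgo k)
  set d : ℕ → M ≃ₜ M := fun k => h k * (A (φ k)).1 with hd
  have hdJ : ∀ k, d k ∈ J := fun k => J.mul_mem (hhJ k) (hAm (φ k)).1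
  have hno : ∀ S Z : Set M, (∀ k, ∃ v ∈ S, (A k).1 v ∈ O ((A k).2 + 1)) → IsClosed Z → p ∉ Z →
      ¬ ∃ᶠ k in atTop, (∀ y ∈ S, d k y ∈ Z) ∧ d k o ∈ Z := by
    intro S Z hS hZ hpZ hfr
    obtain ⟨N, -, hN⟩ := hU.1.mem_iff.1 (hZ.isOpen_compl.mem_nhds hpZ)
    have hev : ∀ᶠ k in atTop, N ≤ (A (φ k)).2 := hcase.nat_tendsto_atTop.eventually_ge_atTop N
    obtain ⟨k, ⟨h1, h2⟩, h3⟩ := (hfr.and_eventually hev).exists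
    obtain ⟨v, hv, hvO⟩ := hS (φ k)
    have hZU : ∀ y ∈ Z, y ∉ U (A (φ k)).2 := fun y hy hyU => hN (hU.2 h3 hyU) hy
    have := hsh (A (φ k)).2 (h k)⁻¹ (J.inv_mem (hhJ k)) (homeo_inv_apply_eq (hhp k))
      ⟨d k v, hZU _ (h1 v hv), by simpa [hd] using hvO⟩ (d k o) (hZU _ h2)
    exact (hAm (φ k)).2.2.2 (by simpa [hd] using this)
  have hV' : ∀ k, ∃ v ∈ V, (A k).1 v ∈ O ((A k).2 + 1) := fun k => (hAm k).2.1
  have hW' : ∀ k, ∃ v ∈ W, (A k).1 v ∈ O ((A k).2 + 1) := fun k => (hAm k).2.2.1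
  obtain ⟨ψ, hψ, hcase'⟩ := exists_subseq_const_or_injective d
  rcases hcase' with hcase' | hcase'
  · have key : ∀ S : Set M, IsClosed S → (∀ k, ∃ v ∈ S, (A k).1 v ∈ O ((A k).2 + 1)) →
        (d (ψ 0))⁻¹ p ∉ S → False := by
      intro S hS hS' hpS
      refine hno S (d (ψ 0) '' S ∪ {d (ψ 0) o}) hS' (((d (ψ 0)).isClosedMap S hS).union
        isClosed_singleton) ?_ ?_
      · rintro (⟨y, hy, hyp⟩ | hy)
        · exact hpS (homeo_eq_inv_apply hyp ▸ hy)
        · refine hpK ?_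
          rw [show p = d (ψ 0) o from hy]
          exact hhK _
      · refine hψ.tendsto_atTop.frequently
          (Eventually.frequently (Eventually.of_forall fun k => ?_))
        rw [hcase' k]
        exact ⟨fun y hy => Or.inl ⟨y, hy, rfl⟩, Or.inr rfl⟩
    by_cases hpV : (d (ψ 0))⁻¹ p ∈ V
    · exact key W hW hW' fun hpW => hVW.le_bot ⟨hpV, hpW⟩
    · exact key V hV hV' hpV
  · obtain ⟨χ, hχ, ζ, ζ', hc⟩ := hJ _ (fun k => hdJ (ψ k)) hcase'
    have hζ' : ζ' ∈ limitSet J :=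
      hc.mem_limitSet_right (fun k => hdJ _) (hcase'.comp hχ.injective)
    have hoc := hc.tendsto_apply (x := o) (fun h => ho (h ▸ hζ'))
    have hζK : ζ ∈ K := hK.isClosed.mem_of_tendsto hoc (Eventually.of_forall fun k => hhK _)
    have hζp : ζ ≠ p := fun h => hpK (h ▸ hζK)
    obtain ⟨Z, hZ, hZc, hZs⟩ := exists_mem_nhds_isClosed_subset (isOpen_ne.mem_nhds hζp)
    have key : ∀ S : Set M, IsClosed S → (∀ k, ∃ v ∈ S, (A k).1 v ∈ O ((A k).2 + 1)) →
        ζ' ∉ S → False := by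
      intro S hS hS' hζS
      refine hno S Z hS' hZc (fun h => hZs h rfl) ?_
      exact (hψ.comp hχ).tendsto_atTop.frequently (Eventually.frequently
        ((hc.eventually_closed hS hζS hZ).and (hoc.eventually_mem hZ)))
    by_cases hpV : ζ' ∈ V
    · exact key W hW hW' fun hpW => hVW.le_bot ⟨hpV, hpW⟩
    · exact key V hV hV' hpV

/-- A sequence of elements of `H` in pairwise distinct right cosets of `J` can be adjusted on
the left by `J` so that a subsequence has its attracting point outside the limit set of `J`. -/
theorem exists_attracting_notMem_limitSet {H J : Subgroup (M ≃ₜ M)} (hH : IsDiscreteConvGroup H)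
    (hJH : J ≤ H) (hne : ∃ c ∈ H, c ∉ J)
    (hD : ∀ h ∈ H, h ∉ J → ∀ p ∈ limitSet J, h p ∉ limitSet J)
    (hE : ∀ p ∈ limitSet J, IsConicalLimitPt J p ∨ IsRelBoundedParabolic J (limitSet H) p)
    {f : ℕ → M ≃ₜ M} (hf : ∀ k, f k ∈ H) (hfJ : ∀ k l, k ≠ l → f k * (f l)⁻¹ ∉ J) :
    ∃ φ : ℕ → ℕ, StrictMono φ ∧ ∃ j : ℕ → M ≃ₜ M, (∀ k, j k ∈ J) ∧ ∃ e ρ : M,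
      e ∉ limitSet J ∧ IsConvSeq (fun k => j k * f (φ k)) e ρ := by
  have hJ : IsDiscreteConvGroup J := hH.mono hJH
  have hinj : ∀ j : ℕ → M ≃ₜ M, (∀ k, j k ∈ J) → Function.Injective fun k => j k * f k := by
    intro j hj k l hkl
    by_contra hne
    apply hfJ k l hne
    have : f k * (f l)⁻¹ = (j k)⁻¹ * j l := by
      rw [mul_inv_eq_iff_eq_mul, mul_assoc, eq_inv_mul_iff_mul_eq]; exact hkl
    rw [this]
    exact J.mul_mem (J.inv_mem (hj k)) (hj l)
  rcases (limitSet J).eq_empty_or_nonempty with hemp | ⟨q₀, hq₀⟩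
  · obtain ⟨φ, hφ, e, ρ, hc⟩ := hH f hf (by simpa using hinj (fun _ => 1) fun _ => J.one_mem)
    exact ⟨φ, hφ, fun _ => 1, fun _ => J.one_mem, e, ρ, by simp [hemp], by
      simp only [one_mul]; exact hc⟩
  obtain ⟨c, hcH, hcJ⟩ := hne
  set o := c q₀ with ho_def
  have hoH : o ∈ limitSet H := apply_mem_limitSet (limitSet_mono hJH hq₀) hcH
  have ho : o ∉ limitSet J := hD c hcH hcJ q₀ hq₀
  let q : Fin 3 → M := fun i => Infinite.natEmbedding M i
  have hq : Function.Injective q := (Infinite.natEmbedding M).injective.comp Fin.val_injective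
  obtain ⟨V, W, hV, hW, hVW, hsep⟩ := exists_separating_pairs (M := M)
  let Par : Set M := {p | p ∈ limitSet J ∧ IsRelBoundedParabolic J (limitSet H) p}
  have hPar : Par.Countable := by
    have : (⋃ g ∈ (J : Set (M ≃ₜ M)), {p | IsParabolicElem g ∧ g p = p}).Countable :=
      hJ.countable.biUnion fun g _ => Set.Subsingleton.countable fun p hp p' hp' =>
        hp.1.2.unique hp.2 hp'.2
    refine this.mono ?_
    rintro p ⟨-, ⟨g, hg, hpar, hgp⟩, -⟩
    exact Set.mem_iUnion₂.2 ⟨g, hg, hpar, hgp⟩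
  have : Countable Par := hPar.to_subtype
  choose U hU O hO hpO hcl hOU hsh using fun p : Par => exists_shells hJ p.2.2.1
  let P : ℕ ⊕ Par → ℕ → Set M := fun t n =>
    Sum.elim (fun l => if n = 0 then interior (V l) else ∅) (fun p => O p (n + 1)) t
  let Q : ℕ ⊕ Par → ℕ → Set M := fun t n =>
    Sum.elim (fun l => if n = 0 then (W l)ᶜ else ∅) (fun p => O p n) t
  have hPQ : ∀ t n, P t n ⊆ Q t n := by
    rintro (l | p) n
    · rcases eq_or_ne n 0 with rfl | hn
      · exact fun y hy hyW => (hVW l).le_bot ⟨interior_subset hy, hyW⟩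
      · simp [P, Q, hn]
    · exact subset_closure.trans (hcl p n)
  have hLF : ∀ t, ∀ X Y : Set M, IsClosed X → IsClosed Y → Disjoint X Y →
      (linkedIndices J o (P t) (Q t) X Y).Finite := by
    rintro (l | p) X Y hX hY hXY
    · refine (finite_linkedIndices_fst hJ ho (n := 0) (P := P (.inl l)) (Q := Q (.inl l))
        (hW l).isOpen_compl ?_ hX hY hXY).subset fun A hA => ⟨hA, ?_⟩
      · exact ((hV l).closure_subset_iff.2 interior_subset).trans
          fun y hy hyW => (hVW l).le_bot ⟨hy, hyW⟩
      · by_contra hn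
        obtain ⟨-, ⟨v, -, hv⟩, -⟩ := hA
        simp [P, hn] at hv
    · exact finite_linkedIndices_shells hJH hJ p.2.1 p.2.2 hoH ho (hU p) (hO p) (hcl p) (hsh p)
        hX hY hXY
  obtain ⟨j, hj, hadj⟩ := exists_adjusted_seq J o hq hPQ V W
    (fun t l => hLF t _ _ (hV l) (hW l) (hVW l)) f
    (fun t k => chainNumber_ne_top fun a b hab => hLF t _ _ isClosed_singleton isClosed_singleton
      (Set.disjoint_singleton.2 fun h => hab (hq ((f k).injective h))))
  set F : ℕ → M ≃ₜ M := fun k => j k * f k with hF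
  have hFH : ∀ k, F k ∈ H := fun k => H.mul_mem (hJH (hj k)) (hf k)
  have hFJ : ∀ k l, k ≠ l → F k * (F l)⁻¹ ∉ J := fun k l hkl hmem => hfJ k l hkl (by
    have : f k * (f l)⁻¹ = (j k)⁻¹ * (F k * (F l)⁻¹) * j l := by simp [hF, mul_assoc]
    rw [this]
    exact J.mul_mem (J.mul_mem (J.inv_mem (hj k)) hmem) (hj l))
  obtain ⟨φ, hφ, x, ρ, hc⟩ := hH F hFH (hinj j hj)
  by_cases hx : x ∉ limitSet J
  · exact ⟨φ, hφ, fun k => j (φ k), fun k => hj _, x, ρ, hx, hc⟩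
  rw [not_not] at hx
  exfalso
  have hxo : o ≠ x := fun h => ho (h ▸ hx)
  rcases hE x hx with hcon | hpar
  · obtain ⟨i, hi, -, a, b, hab, hib, hia⟩ := exists_conicalSeq hJ hcon
    obtain ⟨l, hVa, hWb⟩ := hsep a b hab
    have hgood : ∀ O' ∈ 𝓝 x, ∃ n, i n x ∈ interior (V l) ∧ ∀ y, y ∉ O' → i n y ∈ W l := by
      intro O' hO'
      obtain ⟨n, h1, h2⟩ := ((hia.eventually_mem (isOpen_interior.mem_nhds
        (mem_interior_iff_mem_nhds.2 hVa))).and (hib.eventually_closed (K := (interior O')ᶜ)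
          isOpen_interior.isClosed_compl (by simpa using mem_interior_iff_mem_nhds.2 hO')
          hWb)).exists
      exact ⟨n, h1, fun y hy => h2 y fun h => hy (interior_subset h)⟩
    refine hadj φ x ρ hc hc.not_isOpen_left hxo (.inl l) (fun O' hO' => ?_) ⟨l, fun O' hO' => ?_⟩
    · obtain ⟨n, h1, h2⟩ := hgood O' hO'
      refine ⟨(i n, 0), hi n, (isOpen_interior.preimage (i n).continuous).mem_nhds h1,
        fun y hy => ?_⟩
      by_contra hyO
      exact hy (h2 y hyO)
    · obtain ⟨n, h1, h2⟩ := hgood O' hO'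
      refine Eventually.frequently ?_
      filter_upwards [hc.eventually_maj hq
        ((isOpen_interior.preimage (i n).continuous).mem_nhds h1)] with k hk
      refine ⟨i n, hi n, ?_, fun y hy => ?_⟩
      · obtain ⟨a, b, hab, ha, hb⟩ := hk
        exact ⟨a, b, hab, interior_subset ha, interior_subset hb⟩
      · by_contra hyO
        exact hy (h2 y hyO)
  · have hxP : x ∈ Par := ⟨hx, hpar⟩
    obtain ⟨hpp, K, hK, hxK, hcov⟩ := hpar
    have hmove : ∀ᶠ k in atTop, F (φ k) x ≠ x := by
      have h1 : ∀ k, F (φ k) x = x → F (φ k) ∈ J := fun k hk => by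
        by_contra hn
        exact hD _ (hFH _) hn x hx (by rw [hk]; exact hx)
      by_contra hfr
      obtain ⟨k, hk⟩ := Filter.Frequently.exists (not_eventually.1 hfr)
      obtain ⟨l, hlk, hl⟩ := (frequently_atTop.1 (not_eventually.1 hfr)) (k + 1)
      exact hFJ (φ k) (φ l) (hφ.injective.ne (by omega))
        (J.mul_mem (h1 k (not_not.1 hk)) (J.inv_mem (h1 l (not_not.1 hl))))
    obtain ⟨N, hN⟩ := eventually_atTop.1 hmove
    choose h hhJ hhx hhK using fun k => hcov (F (φ (k + N)) x)
      (apply_mem_limitSet (limitSet_mono hJH hx) (hFH _)) (hN _ (by omega))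
    have hcN : IsConvSeq (fun k => F (φ (k + N))) x ρ :=
      hc.comp_tendsto (tendsto_add_atTop_nat N)
    obtain ⟨ψ, hψ, e, ρ', hψc⟩ := hH (fun k => h k * F (φ (k + N)))
      (fun k => H.mul_mem (hJH (hhJ k)) (hFH _)) (fun k l hkl => by
        by_contra hne
        refine hFJ (φ (k + N)) (φ (l + N)) (hφ.injective.ne (by omega)) ?_
        have : F (φ (k + N)) * (F (φ (l + N)))⁻¹ = (h k)⁻¹ * h l := by
          rw [mul_inv_eq_iff_eq_mul, mul_assoc, eq_inv_mul_iff_mul_eq]; exact hkl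
        rw [this]
        exact J.mul_mem (J.inv_mem (hhJ k)) (hhJ l))
    have he := hψc.tendsto_parabolicPt hH (hpp.mono hJH)
      (fun k => H.mul_mem (hJH (hhJ _)) (hFH _))
    have heK : e ∈ K := hK.isClosed.mem_of_tendsto he (Eventually.of_forall fun k => hhK _)
    have hex : e ≠ x := fun h => hxK (h ▸ heK)
    obtain ⟨χ, hχ, hcase⟩ := exists_subseq_const_or_injective fun k => h (ψ k)
    have hcχ : IsConvSeq (fun k => F (φ (ψ (χ k) + N))) x ρ := hcN.subseq (hψ.comp hχ)
    rcases hcase with hcase | hcase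
    · have h1 := (hcχ.mul_left (h (ψ (χ 0))))
      rw [hhx] at h1
      refine hex ((hψc.subseq hχ).unique_left (h1.congr_eventually
        (Eventually.of_forall fun k => ?_)))
      simp only [Function.comp]
      rw [← hcase k]
    · obtain ⟨ω, hω, a, b, hhc⟩ := hJ _ (fun k => hhJ _) hcase
      obtain ⟨ha, hb⟩ := hhc.eq_of_stabilizes_parabolicPt hJ hpp (fun k => hhJ _)
        (fun k => hhx _)
      rw [ha, hb] at hhc
      obtain ⟨l, hVe, hWx⟩ := hsep e x hex
      refine hadj φ x ρ hc hc.not_isOpen_left hxo (.inr ⟨x, hxP⟩) (fun O' hO' => ?_)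
        ⟨l, fun O' hO' => ?_⟩
      · obtain ⟨n, -, hn⟩ := (hU ⟨x, hxP⟩).1.mem_iff.1 hO'
        exact ⟨(1, n + 1), J.one_mem, (hO ⟨x, hxP⟩ _).mem_nhds (hpO ⟨x, hxP⟩ _),
          (hOU ⟨x, hxP⟩ n).trans hn⟩
      · have hfr : ∃ᶠ k in atTop, ∃ s ∈ J, Maj q (s * F (φ (k + N))) (V l) ∧
            ∀ y, s y ∉ W l → y ∈ O' := by
          refine (hψ.comp (hχ.comp hω)).tendsto_atTop.frequently (Eventually.frequently ?_)
          filter_upwards [((hψc.subseq hχ).subseq hω).eventually_maj hq hVe,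
            hhc.eventually_closed (K := (interior O')ᶜ) isOpen_interior.isClosed_compl
              (by simpa using mem_interior_iff_mem_nhds.2 hO') hWx] with k h1 h2
          refine ⟨h (ψ (χ (ω k))), hhJ _, h1, fun y hy => ?_⟩
          by_contra hyO
          exact hy (h2 y fun h => hyO (interior_subset h))
        exact (tendsto_add_atTop_nat N).frequently hfr

end Cosets

section PingPongWords

variable [CompactSpace M] [TopologicalSpace.MetrizableSpace M] [Infinite M]

/-- Ping-pong position for the amalgam `G` of `A true` and `A false` along `J`, in a form
symmetric in the two factors. -/
structure PingPong (A : Bool → Subgroup (M ≃ₜ M)) (J G : Subgroup (M ≃ₜ M)) (B : Bool → Set M) :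
    Prop where
  disc : ∀ i, IsDiscreteConvGroup (A i)
  le : ∀ i, J ≤ A i
  proper : ∀ i, ∃ c ∈ A i, c ∉ J
  sup_eq : A true ⊔ A false = G
  closed : ∀ i, IsClosed (B i)
  nonempty : ∀ i, (interior (B i)).Nonempty
  disj : ∀ i, Disjoint (interior (B i)) (B !i)
  inv : ∀ i, ∀ j ∈ J, ∀ x ∈ B i, j x ∈ B i
  pp : ∀ i, ∀ g ∈ A i, g ∉ J → ∀ x ∈ B i, g x ∈ interior (B !i)
  lim : ∀ i, ∀ x ∈ limitSet (A i), x ∉ limitSet J → x ∈ interior (B !i)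

/-- Products of alternating letters from `A i ∖ J` starting with index `i` and ending with
index `j`. -/
inductive Word (A : Bool → Subgroup (M ≃ₜ M)) (J : Subgroup (M ≃ₜ M)) :
    Bool → Bool → (M ≃ₜ M) → Prop
  | single {i : Bool} {g : M ≃ₜ M} (hg : g ∈ A i) (hgJ : g ∉ J) : Word A J i i g
  | cons {i j : Bool} {g w : M ≃ₜ M} (hg : g ∈ A i) (hgJ : g ∉ J) (hw : Word A J (!i) j w) :
      Word A J i j (g * w)

lemma eq_or_eq_not (i j : Bool) : j = i ∨ j = !i := by
  revert i j; decide

variable {A : Bool → Subgroup (M ≃ₜ M)} {J G : Subgroup (M ≃ₜ M)} {B : Bool → Set M}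

lemma Word.mul_left_mem (hle : ∀ i, J ≤ A i) {i j : Bool} {w g : M ≃ₜ M} (hw : Word A J i j w)
    (hg : g ∈ J) : Word A J i j (g * w) := by
  cases hw with
  | single h hJ =>
    exact .single ((A i).mul_mem (hle i hg) h) fun h' => hJ ((J.mul_mem_cancel_left hg).1 h')
  | cons h hJ hw =>
    rw [← mul_assoc]
    exact .cons ((A i).mul_mem (hle i hg) h) (fun h' => hJ ((J.mul_mem_cancel_left hg).1 h')) hw

lemma Word.append {i j k : Bool} {v w : M ≃ₜ M} (hv : Word A J i j v) (hw : Word A J (!j) k w) :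
    Word A J i k (v * w) := by
  induction hv with
  | single h hJ => exact .cons h hJ hw
  | cons h hJ _ ih => rw [mul_assoc]; exact .cons h hJ (ih hw)

lemma Word.inv {i j : Bool} {w : M ≃ₜ M} (hw : Word A J i j w) : Word A J j i w⁻¹ := by
  induction hw with
  | single h hJ => exact .single (inv_mem h) fun h' => hJ (by simpa using inv_mem h')
  | @cons i j g w h hJ _ ih =>
    rw [mul_inv_rev]
    refine ih.append ?_
    rw [Bool.not_not]
    exact .single (inv_mem h) fun h' => hJ (by simpa using inv_mem h')

lemma Word.mul_letter {i j : Bool} {w g : M ≃ₜ M} (hw : Word A J i j w) (hle : ∀ i, J ≤ A i)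
    (hg : g ∈ A i) : g * w ∈ J ∨ Word A J i j (g * w) ∨ Word A J (!i) j (g * w) := by
  cases hw with
  | single h hJ =>
    by_cases hJ' : g * w ∈ J
    · exact Or.inl hJ'
    · exact Or.inr (Or.inl (.single ((A i).mul_mem hg h) hJ'))
  | @cons _ _ a u h hJ hu =>
    rw [← mul_assoc]
    by_cases hJ' : g * a ∈ J
    · exact Or.inr (Or.inr (hu.mul_left_mem hle hJ'))
    · exact Or.inr (Or.inl (.cons ((A i).mul_mem hg h) hJ' hu))

lemma Word.exists_letter {i j : Bool} {w : M ≃ₜ M} (hw : Word A J i j w) :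
    ∃ c u, c ∈ A i ∧ c ∉ J ∧ w = c * u ∧ (u = 1 ∧ j = i ∨ Word A J (!i) j u) := by
  cases hw with
  | single h hJ => exact ⟨w, 1, h, hJ, (mul_one w).symm, Or.inl ⟨rfl, rfl⟩⟩
  | cons h hJ hu => exact ⟨_, _, h, hJ, rfl, Or.inr hu⟩

lemma PingPong.factor_le (P : PingPong A J G B) (i : Bool) : A i ≤ G := by
  rw [← P.sup_eq]
  cases i
  exacts [le_sup_right, le_sup_left]

lemma PingPong.word_mem (P : PingPong A J G B) {i j : Bool} {w : M ≃ₜ M} (hw : Word A J i j w) :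
    w ∈ G := by
  induction hw with
  | single h _ => exact P.factor_le _ h
  | cons h _ _ ih => exact G.mul_mem (P.factor_le _ h) ih

lemma PingPong.mem_or_word (P : PingPong A J G B) {g : M ≃ₜ M} (hg : g ∈ G) :
    g ∈ J ∨ ∃ i j, Word A J i j g := by
  have step : ∀ i, ∀ a ∈ A i, ∀ g, (g ∈ J ∨ ∃ i j, Word A J i j g) →
      (a * g ∈ J ∨ ∃ i j, Word A J i j (a * g)) := by
    rintro i a ha g (hg | ⟨k, j, hw⟩)
    · by_cases h : a * g ∈ J
      · exact Or.inl h
      · exact Or.inr ⟨i, i, .single ((A i).mul_mem ha (P.le i hg)) h⟩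
    · rcases eq_or_eq_not i k with rfl | rfl
      · rcases hw.mul_letter P.le ha with h | h | h
        exacts [Or.inl h, Or.inr ⟨_, _, h⟩, Or.inr ⟨_, _, h⟩]
      · by_cases h : a ∈ J
        · exact Or.inr ⟨_, _, hw.mul_left_mem P.le h⟩
        · exact Or.inr ⟨_, _, .cons ha h hw⟩
  rw [← P.sup_eq, Subgroup.sup_eq_closure] at hg
  induction hg using Subgroup.closure_induction_left with
  | one => exact Or.inl J.one_mem
  | mul_left x hx y _ ih => rcases hx with hx | hx <;> exact step _ x hx y ih
  | inv_mul_cancel x hx y _ ih => rcases hx with hx | hx <;> exact step _ x⁻¹ (inv_mem hx) y ih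

/-- Every element of the amalgam factors as an element of `A i` times an alternating word not
starting in `A i`. -/
lemma PingPong.exists_factor (P : PingPong A J G B) (i : Bool) {g : M ≃ₜ M} (hg : g ∈ G) :
    ∃ c u, c ∈ A i ∧ g = c * u ∧ (u = 1 ∨ ∃ j, Word A J (!i) j u) := by
  rcases P.mem_or_word hg with h | ⟨k, j, hw⟩
  · exact ⟨g, 1, P.le i h, (mul_one g).symm, Or.inl rfl⟩
  · rcases eq_or_eq_not i k with rfl | rfl
    · obtain ⟨c, u, hc, -, rfl, hu⟩ := hw.exists_letter
      exact ⟨c, u, hc, rfl, hu.imp And.left fun h => ⟨j, h⟩⟩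
    · exact ⟨1, g, one_mem _, (one_mul g).symm, Or.inr ⟨j, hw⟩⟩

lemma PingPong.word_apply (P : PingPong A J G B) {i j : Bool} {w : M ≃ₜ M} (hw : Word A J i j w)
    {x : M} (hx : x ∈ B j) : w x ∈ interior (B !i) := by
  induction hw with
  | single h hJ => exact P.pp _ _ h hJ x hx
  | cons h hJ _ ih =>
    refine P.pp _ _ h hJ _ ?_
    simpa using interior_subset (ih hx)

lemma PingPong.word_letter (P : PingPong A J G B) {i j : Bool} {w : M ≃ₜ M}
    (hw : Word A J i j w) : ∃ c u, c ∈ A i ∧ c ∉ J ∧ w = c * u ∧ (u = 1 ∨ Word A J (!i) j u) ∧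
      ∀ x ∈ B j, u x ∈ B i := by
  obtain ⟨c, u, hc, hcJ, rfl, hu⟩ := hw.exists_letter
  refine ⟨c, u, hc, hcJ, rfl, hu.imp_left And.left, fun x hx => ?_⟩
  rcases hu with ⟨rfl, rfl⟩ | hu
  · exact hx
  · simpa using interior_subset (P.word_apply hu hx)

lemma PingPong.notMem_of_interior (P : PingPong A J G B) {i : Bool} {x : M}
    (hx : x ∈ interior (B !i)) : x ∉ B i := fun h =>
  (P.disj (!i)).le_bot ⟨hx, by simpa using h⟩

lemma PingPong.limitSet_subset (P : PingPong A J G B) (i : Bool) : limitSet J ⊆ B i := by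
  rintro x ⟨f, hf, -, b, hc⟩
  exact hc.left_mem_of_frequently isOpen_interior (P.nonempty i) (P.closed i)
    (Eventually.frequently (Eventually.of_forall fun k y hy =>
      P.inv i _ (hf k) y (interior_subset hy)))

lemma PingPong.word_apply_notMem (P : PingPong A J G B) {i j : Bool} {w : M ≃ₜ M}
    (hw : Word A J i j w) {p : M} (hp : p ∈ limitSet J) : w p ∉ limitSet J := fun h =>
  P.notMem_of_interior (P.word_apply hw (P.limitSet_subset j hp)) (P.limitSet_subset i h)

lemma PingPong.mem_of_apply_mem_limitSet (P : PingPong A J G B) {g : M ≃ₜ M} (hg : g ∈ G) {p : M}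
    (hp : p ∈ limitSet J) (hgp : g p ∈ limitSet J) : g ∈ J := by
  rcases P.mem_or_word hg with h | ⟨i, j, hw⟩
  · exact h
  · exact absurd hgp (P.word_apply_notMem hw hp)

/-- The degenerate situation in which both factors contain `J` with index two. -/
def Degenerate (A : Bool → Subgroup (M ≃ₜ M)) (J : Subgroup (M ≃ₜ M)) (B : Bool → Set M) : Prop :=
  ∀ i, ∃ c ∈ A i, c ∉ J ∧ ∀ x ∈ B !i, c⁻¹ x ∈ B i

lemma frequently_exists_finite {ι : Type*} [Finite ι] {p : ι → ℕ → Prop}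
    (h : ∃ᶠ k in atTop, ∃ i, p i k) : ∃ i, ∃ᶠ k in atTop, p i k := by
  by_contra hn
  have hn' : ∀ i, ∀ᶠ k in atTop, ¬ p i k := fun i => not_frequently.1 fun h' => hn ⟨i, h'⟩
  exact h ((eventually_all.2 hn').mono fun k hk ⟨i, hi⟩ => hk i hi)

lemma PingPong.swap_of_degenerate (P : PingPong A J G B) (hD : Degenerate A J B) {i : Bool}
    {g : M ≃ₜ M} (hg : g ∈ A i) (hgJ : g ∉ J) (k : Bool) {x : M} (hx : x ∈ B k) :
    g x ∈ B !k := by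
  rcases eq_or_eq_not i k with rfl | rfl
  · exact interior_subset (P.pp _ g hg hgJ x hx)
  obtain ⟨c, hc, hcJ, hcB⟩ := hD i
  have hcoset : c⁻¹ * g⁻¹ ∈ J := by
    by_contra hn
    obtain ⟨y, hy⟩ := P.nonempty i
    have h1 := P.pp i _ ((A i).mul_mem (inv_mem hc) (inv_mem hg)) hn y (interior_subset hy)
    have h2 : g⁻¹ y ∈ B !i := interior_subset
      (P.pp i g⁻¹ (inv_mem hg) (fun h => hgJ (by simpa using inv_mem h)) y (interior_subset hy))
    exact P.notMem_of_interior h1 (hcB _ h2)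
  have := P.inv i _ (inv_mem hcoset) _ (hcB x hx)
  rw [Bool.not_not]
  simpa using this

/-- In the degenerate situation the limit set of the amalgam is empty. -/
lemma PingPong.limitSet_eq_empty_of_degenerate (P : PingPong A J G B) (hD : Degenerate A J B) :
    limitSet G = ∅ := by
  have hS : ∀ g ∈ G, ∃ s : Bool, ∀ i, ∀ x ∈ B i, g x ∈ B (xor s i) := by
    intro g hg
    rw [← P.sup_eq, Subgroup.sup_eq_closure] at hg
    have hA : ∀ i, ∀ g ∈ A i, ∃ s : Bool, ∀ i, ∀ x ∈ B i, g x ∈ B (xor s i) := by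
      intro i g hg
      by_cases hgJ : g ∈ J
      · exact ⟨false, fun k x hx => by simpa using P.inv k g hgJ x hx⟩
      · exact ⟨true, fun k x hx => by simpa using P.swap_of_degenerate hD hg hgJ k hx⟩
    have hmul : ∀ g h : M ≃ₜ M, (∃ s : Bool, ∀ i, ∀ x ∈ B i, g x ∈ B (xor s i)) →
        (∃ s : Bool, ∀ i, ∀ x ∈ B i, h x ∈ B (xor s i)) →
        ∃ s : Bool, ∀ i, ∀ x ∈ B i, (g * h) x ∈ B (xor s i) := by
      rintro g h ⟨s, hs⟩ ⟨t, ht⟩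
      refine ⟨xor s t, fun i x hx => ?_⟩
      rw [Bool.xor_assoc]
      exact hs _ _ (ht _ _ hx)
    induction hg using Subgroup.closure_induction_left with
    | one => exact ⟨false, fun k x hx => by simpa using hx⟩
    | mul_left x hx y _ ih =>
      rcases hx with hx | hx
      exacts [hmul _ _ (hA _ x hx) ih, hmul _ _ (hA _ x hx) ih]
    | inv_mul_cancel x hx y _ ih =>
      rcases hx with hx | hx
      exacts [hmul _ _ (hA _ _ (inv_mem hx)) ih, hmul _ _ (hA _ _ (inv_mem hx)) ih]
  refine eq_empty_of_forall_notMem ?_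
  rintro x ⟨f, hf, -, b, hc⟩
  obtain ⟨s, hs⟩ := frequently_exists_finite
    (Eventually.frequently (f := atTop) (Eventually.of_forall fun k => hS (f k) (hf k)))
  have hx : ∀ i, x ∈ B (xor s i) := fun i =>
    hc.left_mem_of_frequently isOpen_interior (P.nonempty i) (P.closed _)
      (hs.mono fun k hk y hy => hk i y (interior_subset hy))
  obtain ⟨c, hcA, hcJ, hcB⟩ := hD s
  have h1 : x ∈ B s := by simpa using hx false
  have h2 : x ∈ B !s := by simpa using hx true
  have := P.pp s c hcA hcJ _ (hcB x h2)
  rw [homeo_apply_inv_self] at this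
  exact P.notMem_of_interior this h1

lemma PingPong.word_notMem (P : PingPong A J G B) (hD : ¬ Degenerate A J B) {i j : Bool}
    {w : M ≃ₜ M} (hw : Word A J i j w) : w ∉ J := by
  intro hwJ
  rcases eq_or_eq_not i j with rfl | rfl
  · obtain ⟨x, hx⟩ := P.nonempty j
    exact P.notMem_of_interior (P.word_apply hw (interior_subset hx))
      (P.inv j w hwJ x (interior_subset hx))
  · have key : ∀ i w, Word A J i (!i) w → w ∈ J → ∃ c ∈ A i, c ∉ J ∧ ∀ x ∈ B !i, c⁻¹ x ∈ B i := by
      intro i w hw hwJ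
      obtain ⟨c, u, hc, hcJ, rfl, -, hu⟩ := P.word_letter hw
      refine ⟨c, hc, hcJ, fun x hx => ?_⟩
      have := hu _ (P.inv _ _ (inv_mem hwJ) x hx)
      simpa [mul_inv_rev] using this
    refine hD fun k => ?_
    rcases eq_or_eq_not i k with rfl | rfl
    · exact key _ w hw hwJ
    · exact key _ w⁻¹ (by simpa using hw.inv) (inv_mem hwJ)

end PingPongWords

section Discreteness

variable [CompactSpace M] [TopologicalSpace.MetrizableSpace M]

lemma TendstoHomeo.tendsto_inv_mul {f : ℕ → M ≃ₜ M} (hf : TendstoHomeo f) {a b : ℕ → ℕ}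
    (ha : Tendsto a atTop atTop) (hb : Tendsto b atTop atTop) (x : M) :
    Tendsto (fun k => ((f (a k))⁻¹ * f (b k)) x) atTop (𝓝 x) := by
  let _ := TopologicalSpace.metrizableSpaceMetric M
  obtain ⟨h, hh⟩ := hf
  have hu := Metric.tendstoUniformly_iff.1 (ContinuousMap.tendsto_iff_tendstoUniformly.1 hh)
  have key : Tendsto (fun k => h (((f (a k))⁻¹ * f (b k)) x)) atTop (𝓝 (h x)) := by
    rw [Metric.tendsto_nhds]
    intro ε hε
    filter_upwards [ha.eventually (hu (ε / 2) (half_pos hε)),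
      hb.eventually (hu (ε / 2) (half_pos hε))] with k h1 h2
    have h1 : dist (h (((f (a k))⁻¹ * f (b k)) x)) (f (b k) x) < ε / 2 := by
      simpa [toCM] using h1 (((f (a k))⁻¹ * f (b k)) x)
    have h2 : dist (h x) (f (b k) x) < ε / 2 := h2 x
    linarith [dist_triangle_right (h (((f (a k))⁻¹ * f (b k)) x)) (h x) (f (b k) x)]
  simpa [Function.comp_def] using (h.symm.continuous.tendsto _).comp key

variable [Infinite M]

lemma IsDiscreteConvGroup.not_frequently_mem {J : Subgroup (M ≃ₜ M)} (hJ : IsDiscreteConvGroup J)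
    {γ : ℕ → M ≃ₜ M} (hγ : ∀ x, Tendsto (fun k => γ k x) atTop (𝓝 x)) (h1 : ∀ k, γ k ≠ 1) :
    ¬ ∃ᶠ k in atTop, γ k ∈ J := by
  intro hfr
  obtain ⟨φ, hφ, hφJ⟩ := extraction_of_frequently_atTop hfr
  obtain ⟨ψ, hψ, hcase⟩ := exists_subseq_const_or_injective (γ ∘ φ)
  rcases hcase with hcase | hcase
  · refine h1 (φ (ψ 0)) (Homeomorph.ext fun x => ?_)
    refine tendsto_nhds_unique ?_ ((hγ x).comp (hφ.comp hψ).tendsto_atTop)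
    refine tendsto_const_nhds.congr fun k => ?_
    exact congrArg (fun g : M ≃ₜ M => g x) (hcase k).symm
  · obtain ⟨χ, hχ, a, b, hc⟩ := hJ _ (fun k => hφJ (ψ k)) hcase
    obtain ⟨x, hxa, hxb⟩ := exists_ne_ne a b
    exact hxa (tendsto_nhds_unique ((hγ x).comp (hφ.comp (hψ.comp hχ)).tendsto_atTop)
      (hc.tendsto_apply hxb))

variable {A : Bool → Subgroup (M ≃ₜ M)} {J G : Subgroup (M ≃ₜ M)} {B : Bool → Set M}

lemma PingPong.mem_of_apply_mem_interior (P : PingPong A J G B) {i : Bool} {c : M ≃ₜ M}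
    (hc : c ∈ A i) {x : M} (hx : x ∈ B i) (hcx : c x ∈ B i) : c ∈ J := by
  by_contra h
  exact P.notMem_of_interior (P.pp i c hc h x hx) hcx

lemma PingPong.degenerate_side (P : PingPong A J G B) {γ : ℕ → M ≃ₜ M}
    (hγ : ∀ x, Tendsto (fun k => γ k x) atTop (𝓝 x)) {i : Bool}
    (hw : ∃ᶠ k in atTop, Word A J i (!i) (γ k)) :
    ∃ c ∈ A i, c ∉ J ∧ ∀ x ∈ B !i, c⁻¹ x ∈ B i := by
  obtain ⟨k₀, hk₀⟩ := hw.exists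
  obtain ⟨c, u, hc, hcJ, hcu, -, hu⟩ := P.word_letter hk₀
  obtain ⟨x, hx⟩ := P.nonempty i
  have hcx : c x ∈ B !i := interior_subset (P.pp i c hc hcJ x (interior_subset hx))
  have hO : c '' interior (B i) ∈ 𝓝 (c x) := (c.isOpenMap _ isOpen_interior).mem_nhds ⟨x, hx, rfl⟩
  refine ⟨c, hc, hcJ, fun y hy => ?_⟩
  refine ((P.closed i).preimage (c⁻¹).continuous).mem_of_frequently_of_tendsto ?_ (hγ y)
  refine (hw.and_eventually ((hγ (c x)).eventually_mem hO)).mono ?_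
  rintro k ⟨hk, z, hz, hzx⟩
  obtain ⟨d, v, hd, hdJ, hdv, -, hv⟩ := P.word_letter hk
  have hmem : c⁻¹ * d ∈ J := by
    refine P.mem_of_apply_mem_interior ((A i).mul_mem (inv_mem hc) hd) (hv _ hcx) ?_
    have : c⁻¹ (d (v (c x))) = z := by
      have h : c z = d (v (c x)) := by rw [hzx, hdv]; rfl
      rw [← h]; simp
    rw [homeo_mul_apply, this]
    exact interior_subset hz
  have := P.inv i _ hmem _ (hv y hy)
  rw [mem_preimage, hdv]
  simpa using this

lemma PingPong.isDiscreteConvGroup (P : PingPong A J G B) (hD : ¬ Degenerate A J B)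
    (hG : IsConvGroup G) : IsDiscreteConvGroup G := by
  intro f hf hi
  obtain ⟨φ, hφ, hc | hc⟩ := hG f hf hi
  swap
  · exact ⟨φ, hφ, hc⟩
  exfalso
  set γ : ℕ → M ≃ₜ M := fun k => ((f ∘ φ) k)⁻¹ * (f ∘ φ) (k + 1) with hγd
  have hγ : ∀ x, Tendsto (fun k => γ k x) atTop (𝓝 x) :=
    hc.tendsto_inv_mul tendsto_id (tendsto_add_atTop_nat 1)
  have hγ' : ∀ x, Tendsto (fun k => (γ k)⁻¹ x) atTop (𝓝 x) := fun x => by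
    have := hc.tendsto_inv_mul (tendsto_add_atTop_nat 1) tendsto_id x
    refine this.congr fun k => ?_
    simp [hγd, mul_inv_rev]
  have hγG : ∀ k, γ k ∈ G := fun k => G.mul_mem (inv_mem (hf _)) (hf _)
  have h1 : ∀ k, γ k ≠ 1 := fun k h => by
    have := hi (inv_mul_eq_one.1 h)
    exact absurd (hφ.injective this) (by omega)
  have hJ := ((P.disc true).mono (P.le true)).not_frequently_mem hγ h1
  have hw : ∃ᶠ k in atTop, ∃ ij : Bool × Bool, Word A J ij.1 ij.2 (γ k) := by
    refine Eventually.frequently ((not_frequently.1 hJ).mono fun k hk => ?_)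
    rcases P.mem_or_word (hγG k) with h | ⟨i, j, h⟩
    · exact absurd h hk
    · exact ⟨(i, j), h⟩
  obtain ⟨⟨i, j⟩, hij⟩ := frequently_exists_finite hw
  rcases eq_or_eq_not i j with rfl | rfl
  · obtain ⟨x, hx⟩ := P.nonempty j
    obtain ⟨k, hk, hkx⟩ := (hij.and_eventually
      ((hγ x).eventually_mem (isOpen_interior.mem_nhds hx))).exists
    exact P.notMem_of_interior (P.word_apply hk (interior_subset hx)) (interior_subset hkx)
  · refine hD fun k => ?_
    rcases eq_or_eq_not i k with rfl | rfl
    · exact P.degenerate_side hγ hij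
    · exact P.degenerate_side hγ' (hij.mono fun k hk => by simpa using hk.inv)

/-- The hypothesis on the factor `A i` under which translates of `B i` shrink. -/
def RelFinite (A : Bool → Subgroup (M ≃ₜ M)) (J : Subgroup (M ≃ₜ M)) (i : Bool) : Prop :=
  ∀ p ∈ limitSet J, IsConicalLimitPt J p ∨ IsRelBoundedParabolic J (limitSet (A i)) p

lemma PingPong.exists_attracting (P : PingPong A J G B) {i : Bool} (hE : RelFinite A J i)
    {f : ℕ → M ≃ₜ M} (hf : ∀ k, f k ∈ A i) (hfJ : ∀ k l, k ≠ l → f k * (f l)⁻¹ ∉ J) :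
    ∃ φ : ℕ → ℕ, StrictMono φ ∧ ∃ j : ℕ → M ≃ₜ M, (∀ k, j k ∈ J) ∧ ∃ e ρ : M,
      e ∈ interior (B !i) ∧ ρ ∈ limitSet (A i) ∧ IsConvSeq (fun k => j k * f (φ k)) e ρ := by
  obtain ⟨φ, hφ, j, hj, e, ρ, he, hc⟩ := exists_attracting_notMem_limitSet (P.disc i) (P.le i)
    (P.proper i) (fun h hh hhJ p hp => P.word_apply_notMem (.single hh hhJ) hp) hE hf hfJ
  have hA : ∀ k, j k * f (φ k) ∈ A i := fun k => (A i).mul_mem (P.le i (hj k)) (hf _)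
  have hi : Function.Injective fun k => j k * f (φ k) := by
    intro k l hkl
    by_contra hne
    refine hfJ (φ k) (φ l) (hφ.injective.ne hne) ?_
    have : f (φ k) * (f (φ l))⁻¹ = (j k)⁻¹ * j l := by
      rw [mul_inv_eq_iff_eq_mul, mul_assoc, eq_inv_mul_iff_mul_eq]; exact hkl
    rw [this]
    exact J.mul_mem (J.inv_mem (hj k)) (hj l)
  exact ⟨φ, hφ, j, hj, e, ρ, P.lim i e (hc.mem_limitSet hA hi) he,
    hc.mem_limitSet_right hA hi, hc⟩

/-- Translates of `B i` by elements in distinct cosets of `J` shrink to points. -/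
lemma PingPong.exists_shrinking (P : PingPong A J G B) {i : Bool} (hE : RelFinite A J i)
    {c : ℕ → M ≃ₜ M} (hc : ∀ k, c k ∈ A i) (hcJ : ∀ k l, k ≠ l → (c k)⁻¹ * c l ∉ J) :
    ∃ φ : ℕ → ℕ, StrictMono φ ∧ ∃ j : ℕ → M ≃ₜ M, (∀ k, j k ∈ J) ∧ ∃ z e : M,
      z ∈ limitSet (A i) ∧ e ∈ interior (B !i) ∧ IsConvSeq (fun k => c (φ k) * j k) z e := by
  obtain ⟨φ, hφ, j, hj, e, ρ, he, hρ, hconv⟩ := P.exists_attracting hE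
    (f := fun k => (c k)⁻¹) (fun k => inv_mem (hc k)) (fun k l hkl => by simpa using hcJ k l hkl)
  refine ⟨φ, hφ, fun k => (j k)⁻¹, fun k => inv_mem (hj k), ρ, e, hρ, he, ?_⟩
  simpa [mul_inv_rev] using hconv.inv

lemma PingPong.eventually_mem_of_shrinking (P : PingPong A J G B) {i : Bool} {c j : ℕ → M ≃ₜ M}
    (hj : ∀ k, j k ∈ J) {z e : M} (he : e ∈ interior (B !i))
    (hc : IsConvSeq (fun k => c k * j k) z e) {U : Set M} (hU : U ∈ 𝓝 z) :
    ∀ᶠ k in atTop, ∀ x ∈ B i, c k x ∈ U := by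
  filter_upwards [hc.eventually_closed (P.closed i) (P.notMem_of_interior he) hU] with k hk x hx
  simpa using hk _ (P.inv i _ (inv_mem (hj k)) x hx)

lemma exists_subseq_coset (J : Subgroup (M ≃ₜ M)) (c : ℕ → M ≃ₜ M) :
    ∃ φ : ℕ → ℕ, StrictMono φ ∧ ((∀ k l, (c (φ k))⁻¹ * c (φ l) ∈ J) ∨
      ∀ k l, k ≠ l → (c (φ k))⁻¹ * c (φ l) ∉ J) := by
  obtain ⟨φ, hφ, h⟩ := exists_subseq_rel_or_not (fun a b : M ≃ₜ M => a⁻¹ * b ∈ J)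
    (fun a b h => by simpa [mul_inv_rev] using J.inv_mem h)
    (fun a b c h1 h2 => by simpa [mul_assoc] using J.mul_mem h1 h2) c
  refine ⟨φ, hφ, h.imp_left fun h k l => ?_⟩
  rcases eq_or_ne k l with rfl | hkl
  · simp
  · exact h k l hkl

lemma PingPong.exists_compact_translates (P : PingPong A J G B) {i : Bool} (hE : RelFinite A J i)
    {c : ℕ → M ≃ₜ M} (hc : ∀ k, c k ∈ A i) (hcJ : ∀ k, c k ∉ J) :
    ∃ φ : ℕ → ℕ, StrictMono φ ∧ ∃ j : ℕ → M ≃ₜ M, (∀ k, j k ∈ J) ∧ ∃ C : Set M, IsClosed C ∧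
      C ⊆ interior (B !i) ∧ ∀ k, ∀ x ∈ B i, (j k * c (φ k)) x ∈ C := by
  have himg : ∀ d ∈ A i, d ∉ J → IsClosed (d '' B i) ∧ d '' B i ⊆ interior (B !i) := by
    intro d hd hdJ
    refine ⟨d.isClosedMap _ (P.closed i), ?_⟩
    rintro _ ⟨x, hx, rfl⟩
    exact P.pp i d hd hdJ x hx
  obtain ⟨φ, hφ, hcase⟩ := exists_subseq_coset J fun k => (c k)⁻¹
  simp only [inv_inv] at hcase
  rcases hcase with hcase | hcase
  · refine ⟨φ, hφ, fun k => c (φ 0) * (c (φ k))⁻¹, fun k => hcase 0 k, c (φ 0) '' B i,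
      (himg _ (hc _) (hcJ _)).1, (himg _ (hc _) (hcJ _)).2, fun k x hx => ⟨x, hx, by simp⟩⟩
  obtain ⟨ψ, hψ, j, hj, e, ρ, he, -, hconv⟩ := P.exists_attracting hE (fun k => hc (φ k)) hcase
  set d : ℕ → M ≃ₜ M := fun k => j k * c (φ (ψ k)) with hd
  have hdA : ∀ k, d k ∈ A i := fun k => (A i).mul_mem (P.le i (hj k)) (hc _)
  have hdJ : ∀ k, d k ∉ J := fun k h => hcJ _ ((J.mul_mem_cancel_left (hj k)).1 h)
  obtain ⟨χ, hχ, hcase'⟩ := exists_subseq_coset J d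
  rcases hcase' with hcase' | hcase'
  · refine ⟨φ ∘ ψ ∘ χ, hφ.comp (hψ.comp hχ), fun k => j (χ k), fun k => hj _, d (χ 0) '' B i,
      (himg _ (hdA _) (hdJ _)).1, (himg _ (hdA _) (hdJ _)).2, fun k x hx => ?_⟩
    exact ⟨_, P.inv i _ (hcase' 0 k) x hx, by simp [hd]⟩
  · obtain ⟨ω, hω, j', hj', z, e', -, he', hz⟩ := P.exists_shrinking hE (fun k => hdA (χ k)) hcase'
    obtain ⟨x, hx, hxρ⟩ := exists_mem_ne_of_not_isOpen hconv.not_isOpen_right isOpen_interior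
      (P.nonempty i)
    have hze : z = e := by
      refine tendsto_nhds_unique (fun U hU => ?_)
        ((hconv.subseq (hχ.comp hω)).tendsto_apply hxρ)
      exact (P.eventually_mem_of_shrinking (c := fun k => d (χ (ω k))) hj' he' hz hU).mono
        fun k hk => hk x (interior_subset hx)
    subst hze
    obtain ⟨C, hC, hCc, hCs⟩ := exists_mem_nhds_isClosed_subset (isOpen_interior.mem_nhds he)
    obtain ⟨N, hN⟩ := eventually_atTop.1
      (P.eventually_mem_of_shrinking (c := fun k => d (χ (ω k))) hj' he' hz hC)
    have hsh : StrictMono fun k : ℕ => k + N := fun a b h => by dsimp only; omega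
    exact ⟨φ ∘ ψ ∘ χ ∘ ω ∘ (· + N), hφ.comp (hψ.comp (hχ.comp (hω.comp hsh))),
      fun k => j (χ (ω (k + N))), fun k => hj _, C, hCc, hCs, fun k x hx => hN _ (by omega) x hx⟩

end Discreteness

section Factors

variable [CompactSpace M] [TopologicalSpace.MetrizableSpace M] [Infinite M]

lemma IsRelBoundedParabolic.isBoundedParabolicPt {J H : Subgroup (M ≃ₜ M)} {p : M}
    (h : IsRelBoundedParabolic J (limitSet H) p) (hJH : J ≤ H) : IsBoundedParabolicPt H p := by
  obtain ⟨hp, K, hK, hpK, hcov⟩ := h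
  refine ⟨hp.mono hJH, K ∩ limitSet H, hK.inter_right (isClosed_limitSet H),
    fun y hy => ⟨hy.2, fun h => hpK (by rw [← show y = p from h]; exact hy.1)⟩, fun y hy => ?_⟩
  obtain ⟨g, hg, hgp, hgK⟩ := hcov y hy.1 hy.2
  exact ⟨g, hJH hg, hgp, hgK, apply_mem_limitSet hy.1 (hJH hg)⟩

variable {A : Bool → Subgroup (M ≃ₜ M)} {J G : Subgroup (M ≃ₜ M)} {B : Bool → Set M}

lemma PingPong.relFinite_of_isGeomFinite (P : PingPong A J G B) (hGd : IsDiscreteConvGroup G)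
    (hJ : IsGeomFinite J) (hG : IsGeomFinite G) (i : Bool) : RelFinite A J i := by
  intro p hp
  have hJG : J ≤ G := (P.le i).trans (P.factor_le i)
  rcases hJ p hp with h | h
  · exact Or.inl h
  rcases hG p (limitSet_mono hJG hp) with h' | ⟨-, K, hK, hKs, hcov⟩
  · exact absurd h' ((h.1.mono hJG).not_isConicalLimitPt hGd)
  · refine Or.inr ⟨h.1, K, hK, fun hpK => (hKs hpK).2 rfl, fun x hx hxp => ?_⟩
    obtain ⟨g, hg, hgp, hgK⟩ := hcov x ⟨limitSet_mono (P.factor_le i) hx, hxp⟩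
    exact ⟨g, P.mem_of_apply_mem_limitSet hg hp (by rwa [hgp]), hgp, hgK⟩

lemma PingPong.word_apply_of_forall (P : PingPong A J G B) {i j : Bool} {u : M ≃ₜ M} {x : M}
    (hx : ∀ c ∈ A i, c x ∈ interior (B !i)) (hu : Word A J (!i) j u) : u x ∈ interior (B i) := by
  rcases eq_or_eq_not i j with rfl | rfl
  · obtain ⟨d, v, hd, -, hdv, hv⟩ := hu.inv.exists_letter
    rcases hv with ⟨-, hv⟩ | hv
    · simp at hv
    · have hu' : u = v⁻¹ * d⁻¹ := by rw [← mul_inv_rev, ← hdv, inv_inv]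
      rw [hu', homeo_mul_apply]
      simpa using P.word_apply hv.inv (interior_subset (hx _ (inv_mem hd)))
  · simpa using P.word_apply hu (interior_subset (by simpa using hx 1 (one_mem _)))

lemma PingPong.mem_factor_of_apply_eq (P : PingPong A J G B) {i : Bool} {x : M}
    (hx : ∀ c ∈ A i, c x ∈ interior (B !i)) {g : M ≃ₜ M} (hg : g ∈ G) (hgx : g x = x) :
    g ∈ A i := by
  obtain ⟨c, u, hc, rfl, rfl | ⟨j, hu⟩⟩ := P.exists_factor i hg
  · simpa using hc
  · have h1 := P.word_apply_of_forall hx hu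
    have h2 := hx _ (inv_mem hc)
    rw [← homeo_eq_inv_apply (show c (u x) = x from hgx)] at h2
    exact absurd (interior_subset h1) (P.notMem_of_interior h2)

lemma PingPong.isConicalLimitPt_factor (P : PingPong A J G B) (hGd : IsDiscreteConvGroup G)
    {i j : Bool} (hE : RelFinite A J i) {x : M} (hx : ∀ c ∈ A i, c x ∈ interior (B !i))
    {c w : ℕ → M ≃ₜ M} (hc : ∀ k, c k ∈ A i) (hw : ∀ k, Word A J (!i) j (w k)) {a b : M}
    (hab : a ≠ b) (hconv : IsConvSeq (fun k => (c k * w k)⁻¹) b x)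
    (ha : Tendsto (fun k => (c k * w k)⁻¹ x) atTop (𝓝 a)) : IsConicalLimitPt (A i) x := by
  have hF : IsConvSeq (fun k => c k * w k) x b := by simpa only [inv_inv] using hconv.inv
  obtain ⟨φ, hφ, hcase⟩ := exists_subseq_coset J c
  rcases hcase with hcase | hcase
  · have hmem : x ∈ c (φ 0) '' B i := by
      refine (hF.subseq hφ).left_mem_of_frequently isOpen_interior (P.nonempty j)
        ((c (φ 0)).isClosedMap _ (P.closed i))
        (Eventually.frequently (Eventually.of_forall fun k y hy => ?_))
      have hwy : w (φ k) y ∈ B i := by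
        simpa using interior_subset (P.word_apply (hw (φ k)) (interior_subset hy))
      exact ⟨_, P.inv i _ (hcase 0 k) _ hwy, by simp⟩
    obtain ⟨y, hy, hyx⟩ := hmem
    have := hx _ (inv_mem (hc (φ 0)))
    rw [← homeo_eq_inv_apply hyx] at this
    exact absurd hy (P.notMem_of_interior this)
  obtain ⟨ψ, hψ, s, hs, z, e, -, he, hd⟩ := P.exists_shrinking hE (fun k => hc (φ k)) hcase
  obtain ⟨y, hy, hyb⟩ := exists_mem_ne_of_not_isOpen hF.not_isOpen_right isOpen_interior
    (P.nonempty j)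
  have hzx : z = x := by
    refine tendsto_nhds_unique (fun U hU => ?_) ((hF.subseq (hφ.comp hψ)).tendsto_apply hyb)
    refine (P.eventually_mem_of_shrinking (c := fun k => c (φ (ψ k))) hs he hd hU).mono
      fun k hk => hk (w (φ (ψ k)) y) ?_
    simpa using interior_subset (P.word_apply (hw (φ (ψ k))) (interior_subset hy))
  subst hzx
  obtain ⟨a', -, χ, hχ, ha'⟩ := isCompact_univ.tendsto_subseq
    (fun k => mem_univ ((c (φ (ψ k)) * s k)⁻¹ z))
  have hdχ : IsConvSeq (fun k => (c (φ (ψ (χ k))) * s (χ k))⁻¹) e z := (hd.subseq hχ).inv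
  by_cases hae : a' ≠ e
  · refine isConicalLimitPt_of_conicalSeq (fun k => ?_) (fun k l hkl => ?_) hae hdχ ha'
    · exact inv_mem ((A i).mul_mem (hc _) (P.le i (hs _)))
    · by_contra hne
      refine hcase (ψ (χ k)) (ψ (χ l)) (hψ.injective.ne (hχ.injective.ne hne)) ?_
      have : (c (φ (ψ (χ k))))⁻¹ * c (φ (ψ (χ l))) = s (χ k) * (s (χ l))⁻¹ := by
        rw [inv_mul_eq_iff_eq_mul, ← mul_assoc, eq_mul_inv_iff_mul_eq]
        exact (inv_injective hkl).symm
      rw [this]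
      exact J.mul_mem (hs _) (inv_mem (hs _))
  · rw [not_not] at hae
    subst hae
    exfalso
    set v : ℕ → M ≃ₜ M := fun k => (s (χ k))⁻¹ * w (φ (ψ (χ k))) with hv
    set d : ℕ → M ≃ₜ M := fun k => c (φ (ψ (χ k))) * s (χ k) with hdd
    have hvw : ∀ k, Word A J (!i) j (v k) := fun k => (hw _).mul_left_mem P.le (inv_mem (hs _))
    have hfac : ∀ k, (c (φ (ψ (χ k))) * w (φ (ψ (χ k))))⁻¹ = (v k)⁻¹ * (d k)⁻¹ := fun k => by
      simp [hv, hdd, mul_assoc]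
    have hmono := hφ.comp (hψ.comp hχ)
    have hconv' : IsConvSeq (fun k => (v k)⁻¹ * (d k)⁻¹) b z :=
      (hconv.subseq hmono).congr_eventually (Eventually.of_forall hfac)
    have hlim : Tendsto (fun k => (v k)⁻¹ ((d k)⁻¹ z)) atTop (𝓝 a) :=
      (ha.comp hmono.tendsto_atTop).congr fun k =>
        congrArg (fun g : M ≃ₜ M => g z) (hfac k)
    obtain ⟨y', hy', -⟩ := exists_ne_ne z z
    obtain ⟨ω, hω, hcase'⟩ := exists_subseq_const_or_injective v
    have hb := (hconv'.subseq hω).tendsto_apply hy'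
    have hla := hlim.comp hω.tendsto_atTop
    have hdy := (hdχ.subseq hω).tendsto_apply hy'
    have hdz : Tendsto (fun k => (d (ω k))⁻¹ z) atTop (𝓝 a') := ha'.comp hω.tendsto_atTop
    rcases hcase' with hcase' | hcase'
    · have hcont := ((v (ω 0))⁻¹).continuous.tendsto a'
      refine hab (Eq.trans (b := (v (ω 0))⁻¹ a') (tendsto_nhds_unique hla ?_)
        (tendsto_nhds_unique hb ?_).symm)
      · exact (hcont.comp hdz).congr fun k => by simp [hcase' k]
      · exact (hcont.comp hdy).congr fun k => by simp [hcase' k, hdd]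
    · obtain ⟨τ, hτ, p, q, hpq⟩ := hGd _ (fun k => P.word_mem (hvw (ω k))) hcase'
      have hp : p ∈ B i := by
        refine hpq.left_mem_of_frequently isOpen_interior (P.nonempty j) (P.closed i)
          (Eventually.frequently (Eventually.of_forall fun k y hy => ?_))
        simpa using interior_subset (P.word_apply (hvw _) (interior_subset hy))
      have hap : a' ≠ p := fun h => P.notMem_of_interior he (h ▸ hp)
      exact hab ((tendsto_nhds_unique (hla.comp hτ.tendsto_atTop)
        (hpq.inv.tendsto (hdz.comp hτ.tendsto_atTop) hap)).trans
        (tendsto_nhds_unique (hb.comp hτ.tendsto_atTop)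
        (hpq.inv.tendsto (hdy.comp hτ.tendsto_atTop) hap)).symm)

theorem PingPong.isGeomFinite_factor (P : PingPong A J G B) (hGd : IsDiscreteConvGroup G)
    (hJ : IsGeomFinite J) (hG : IsGeomFinite G) (i : Bool) : IsGeomFinite (A i) := by
  intro x hx
  have hE := P.relFinite_of_isGeomFinite hGd hJ hG i
  by_cases hxJ : ∃ c ∈ A i, c x ∈ limitSet J
  · obtain ⟨c, hc, hcx⟩ := hxJ
    rcases hE _ hcx with h | h
    · left
      simpa using (h.mono (P.le i)).translate (inv_mem hc)
    · right
      simpa using (h.isBoundedParabolicPt (P.le i)).translate (inv_mem hc)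
  have hxB : ∀ c ∈ A i, c x ∈ interior (B !i) := fun c hc =>
    P.lim i _ (apply_mem_limitSet hx hc) fun h => hxJ ⟨c, hc, h⟩
  rcases hG x (limitSet_mono (P.factor_le i) hx) with h | ⟨⟨g, hg, hgp, hgx⟩, K, hK, hKs, hcov⟩
  · left
    obtain ⟨f, hf, hi, a, b, hab, hconv, ha⟩ := exists_conicalSeq hGd h
    choose c w hc hcw hw using fun k => P.exists_factor i (inv_mem (hf k))
    have hfcw : ∀ k, f k = (c k * w k)⁻¹ := fun k => by rw [← hcw, inv_inv]
    by_cases hfr : ∃ᶠ k in atTop, w k = 1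
    · obtain ⟨φ, hφ, hφ1⟩ := extraction_of_frequently_atTop hfr
      refine isConicalLimitPt_of_conicalSeq (fun k => ?_) (hi.comp hφ.injective) hab
        (hconv.subseq hφ) (ha.comp hφ.tendsto_atTop)
      simp only [Function.comp, hfcw, hφ1, mul_one]
      exact inv_mem (hc _)
    · have hfr' : ∃ᶠ k in atTop, ∃ j, Word A J (!i) j (w k) :=
        Eventually.frequently ((not_frequently.1 hfr).mono fun k hk => (hw k).resolve_left hk)
      obtain ⟨j, hj⟩ := frequently_exists_finite hfr'
      obtain ⟨φ, hφ, hφj⟩ := extraction_of_frequently_atTop hj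
      refine P.isConicalLimitPt_factor hGd hE hxB (fun k => hc (φ k)) hφj hab
        ((hconv.subseq hφ).congr_eventually (Eventually.of_forall fun k => hfcw _)) ?_
      exact (ha.comp hφ.tendsto_atTop).congr fun k =>
        congrArg (fun g : M ≃ₜ M => g x) (hfcw (φ k))
  · right
    refine ⟨⟨g, P.mem_factor_of_apply_eq hxB hg hgx, hgp, hgx⟩, K ∩ limitSet (A i),
      hK.inter_right (isClosed_limitSet _), fun y hy => ⟨hy.2, (hKs hy.1).2⟩, fun y hy => ?_⟩
    obtain ⟨h, hh, hhx, hhK⟩ := hcov y ⟨limitSet_mono (P.factor_le i) hy.1, hy.2⟩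
    have hhA := P.mem_factor_of_apply_eq hxB hh hhx
    exact ⟨h, hhA, hhx, hhK, apply_mem_limitSet hy.1 hhA⟩

end Factors

section Amalgam

variable [CompactSpace M] [TopologicalSpace.MetrizableSpace M] [Infinite M]
variable {A : Bool → Subgroup (M ≃ₜ M)} {J G : Subgroup (M ≃ₜ M)} {B : Bool → Set M}

/-- `x` is the attracting point of a convergence sequence of alternating words starting with a
letter from `A i`. -/
def IsWordLimit (A : Bool → Subgroup (M ≃ₜ M)) (J : Subgroup (M ≃ₜ M)) (i : Bool) (x : M) :
    Prop :=
  ∃ (f : ℕ → M ≃ₜ M) (j : Bool), (∀ k, Word A J i j (f k)) ∧ Function.Injective f ∧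
    ∃ b, IsConvSeq f x b

lemma PingPong.mem_of_isWordLimit (P : PingPong A J G B) {i : Bool} {x : M}
    (hx : IsWordLimit A J i x) : x ∈ B !i := by
  obtain ⟨f, j, hf, -, b, hc⟩ := hx
  exact hc.left_mem_of_frequently isOpen_interior (P.nonempty j) (P.closed _)
    (Eventually.frequently (Eventually.of_forall fun k y hy =>
      interior_subset (P.word_apply (hf k) (interior_subset hy))))

lemma PingPong.mem_limitSet_or_isWordLimit_of_factor (P : PingPong A J G B) {i : Bool}
    (hE : RelFinite A J i) {c w : ℕ → M ≃ₜ M} (hc : ∀ k, c k ∈ A i)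
    (hw : ∀ k, w k = 1 ∨ ∃ j, Word A J (!i) j (w k))
    (hinj : Function.Injective fun k => c k * w k) {x b : M}
    (hconv : IsConvSeq (fun k => c k * w k) x b) :
    x ∈ limitSet (A i) ∨ ∃ k, IsWordLimit A J (!i) ((c k)⁻¹ x) := by
  by_cases hfr : ∃ᶠ k in atTop, w k = 1
  · obtain ⟨φ, hφ, hφ1⟩ := extraction_of_frequently_atTop hfr
    refine Or.inl ((hconv.subseq hφ).mem_limitSet (fun k => ?_) (hinj.comp hφ.injective))
    simp only [Function.comp, hφ1, mul_one]
    exact hc _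
  obtain ⟨j, hj⟩ := frequently_exists_finite
    (Eventually.frequently ((not_frequently.1 hfr).mono fun k hk => (hw k).resolve_left hk))
  obtain ⟨φ, hφ, hφj⟩ := extraction_of_frequently_atTop hj
  obtain ⟨ψ, hψ, hcase⟩ := exists_subseq_coset J fun k => c (φ k)
  have hconv' := hconv.subseq (hφ.comp hψ)
  rcases hcase with hcase | hcase
  · refine Or.inr ⟨φ (ψ 0), fun k => (c (φ (ψ 0)))⁻¹ * (c (φ (ψ k)) * w (φ (ψ k))), j,
      fun k => ?_, fun k l hkl => ?_, b, hconv'.mul_left _⟩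
    · simp only [← mul_assoc]
      exact (hφj _).mul_left_mem P.le (hcase 0 k)
    · exact (hφ.comp hψ).injective (hinj (mul_left_cancel hkl))
  · obtain ⟨χ, hχ, s, hs, z, e, hz, he, hd⟩ := P.exists_shrinking hE (fun k => hc (φ (ψ k)))
      (fun k l hkl => hcase k l hkl)
    obtain ⟨y, hy, hyb⟩ := exists_mem_ne_of_not_isOpen hconv.not_isOpen_right isOpen_interior
      (P.nonempty j)
    left
    convert hz
    refine tendsto_nhds_unique ((hconv'.subseq hχ).tendsto_apply hyb) (fun U hU => ?_)
    refine (P.eventually_mem_of_shrinking (c := fun k => c (φ (ψ (χ k)))) hs he hd hU).mono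
      fun k hk => hk (w (φ (ψ (χ k))) y) ?_
    simpa using interior_subset (P.word_apply (hφj (ψ (χ k))) (interior_subset hy))

lemma PingPong.mem_limitSet_or_isWordLimit (P : PingPong A J G B) {i : Bool}
    (hE : RelFinite A J i) {x : M} (hx : x ∈ limitSet G) :
    x ∈ limitSet (A i) ∨ ∃ c ∈ A i, IsWordLimit A J (!i) (c⁻¹ x) := by
  obtain ⟨f, hf, hi, b, hconv⟩ := hx
  choose c w hc hcw hw using fun k => P.exists_factor i (hf k)
  obtain rfl : f = fun k => c k * w k := funext hcw
  exact (P.mem_limitSet_or_isWordLimit_of_factor hE hc hw hi hconv).imp_right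
    fun ⟨k, hk⟩ => ⟨_, hc k, hk⟩

lemma PingPong.mem_limitSet_or_isWordLimit_of_isWordLimit (P : PingPong A J G B) {i : Bool}
    (hE : RelFinite A J i) {x : M} (hx : IsWordLimit A J i x) :
    x ∈ limitSet (A i) ∨ ∃ c ∈ A i, c ∉ J ∧ IsWordLimit A J (!i) (c⁻¹ x) := by
  obtain ⟨f, j, hf, hi, b, hconv⟩ := hx
  choose c w hc hcJ hcw hw using fun k => (hf k).exists_letter
  obtain rfl : f = fun k => c k * w k := funext hcw
  exact (P.mem_limitSet_or_isWordLimit_of_factor hE hc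
    (fun k => (hw k).imp And.left fun h => ⟨j, h⟩) hi hconv).imp_right
    fun ⟨k, hk⟩ => ⟨_, hc k, hcJ k, hk⟩

lemma PingPong.exists_mem_limitSet_or_mem_translate (P : PingPong A J G B)
    (hE : ∀ i, RelFinite A J i) {x : M} (hx : x ∈ limitSet G) :
    ∃ i, x ∈ limitSet (A i) ∨ ∃ c ∈ A i, c ∉ J ∧ c⁻¹ x ∈ B i := by
  rcases P.mem_limitSet_or_isWordLimit (hE true) hx with h | ⟨c, hc, h⟩
  · exact ⟨true, Or.inl h⟩
  by_cases hcJ : c ∈ J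
  · refine ⟨false, ?_⟩
    have hcA := P.le false hcJ
    rcases P.mem_limitSet_or_isWordLimit_of_isWordLimit (hE false) h with h' | ⟨d, hd, hdJ, h'⟩
    · exact Or.inl ((apply_mem_limitSet_iff (inv_mem hcA)).1 h')
    · refine Or.inr ⟨c * d, (A false).mul_mem hcA hd,
        fun h => hdJ ((J.mul_mem_cancel_left hcJ).1 h), ?_⟩
      simpa [mul_inv_rev] using P.mem_of_isWordLimit h'
  · exact ⟨true, Or.inr ⟨c, hc, hcJ, by simpa using P.mem_of_isWordLimit h⟩⟩

/-- A word limit point no translate of which is a limit point of a factor is conical. -/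
lemma PingPong.isConicalLimitPt_of_isWordLimit (P : PingPong A J G B) (hD : ¬ Degenerate A J B)
    (hGd : IsDiscreteConvGroup G) (hE : ∀ i, RelFinite A J i) {i : Bool} {x : M}
    (hx : IsWordLimit A J i x) (hxA : ∀ g ∈ G, ∀ i, g x ∉ limitSet (A i)) :
    IsConicalLimitPt G x := by
  let S := {g : M ≃ₜ M // g ∈ G ∧ IsWordLimit A J i (g⁻¹ x)}
  have step : ∀ s : S, ∃ c ∈ A i, c ∉ J ∧ c⁻¹ (s.1⁻¹ x) ∈ B i ∧
      ∃ t : S, Word A J i (!i) (s.1⁻¹ * t.1) := by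
    rintro ⟨g, hg, hgx⟩
    obtain ⟨c, hc, hcJ, hcx⟩ := (P.mem_limitSet_or_isWordLimit_of_isWordLimit (hE i)
      hgx).resolve_left (hxA _ (inv_mem hg) i)
    obtain ⟨d, hd, hdJ, hdx⟩ := (P.mem_limitSet_or_isWordLimit_of_isWordLimit (hE !i)
      hcx).resolve_left (hxA (c⁻¹ * g⁻¹) (G.mul_mem (inv_mem (P.factor_le i hc)) (inv_mem hg)) !i)
    refine ⟨c, hc, hcJ, by simpa using P.mem_of_isWordLimit hcx, ⟨g * (c * d),
      G.mul_mem hg (G.mul_mem (P.factor_le _ hc) (P.factor_le _ hd)), ?_⟩, ?_⟩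
    · simpa [mul_inv_rev] using hdx
    · simpa using Word.cons hc hcJ (Word.single hd hdJ)
  choose c hc hcJ hcB next hnext using step
  let s : ℕ → S := fun n => next^[n] ⟨1, one_mem _, by simpa using hx⟩
  have hs : ∀ n, s (n + 1) = next (s n) := fun n => Function.iterate_succ_apply' _ _ _
  set g : ℕ → M ≃ₜ M := fun n => (s n).1 with hgd
  have hu : ∀ n, Word A J i (!i) ((g n)⁻¹ * g (n + 1)) := fun n => by
    simp only [hgd, hs]; exact hnext _
  have hgB : ∀ n, ∀ y ∈ B i, (g n)⁻¹ y ∈ B i := by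
    intro n
    induction n with
    | zero => intro y hy; simpa [hgd, s] using hy
    | succ n ih =>
      intro y hy
      have := P.word_apply (hu n).inv (x := (g n)⁻¹ y) (by simpa using ih y hy)
      simpa [mul_inv_rev] using interior_subset this
  have hseg : ∀ m n, m < n → Word A J i (!i) ((g m)⁻¹ * g n) := by
    intro m n hmn
    induction n, hmn using Nat.le_induction with
    | base => exact hu m
    | succ n _ ih =>
      have := ih.append (w := (g n)⁻¹ * g (n + 1)) (by simpa using hu n)
      simpa [mul_assoc] using this
  obtain ⟨φ, hφ, j, hj, C, hC, hCB, hjC⟩ := P.exists_compact_translates (hE i)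
    (fun n => hc (s n)) (fun n => hcJ (s n))
  set f : ℕ → M ≃ₜ M := fun k => j k * (g (φ k))⁻¹ with hfd
  have hJG : J ≤ G := (P.le i).trans (P.factor_le i)
  have hfG : ∀ k, f k ∈ G := fun k => G.mul_mem (hJG (hj k)) (inv_mem (s _).2.1)
  have hlt : ∀ k l, k < l → f k ≠ f l := by
    intro k l hkl h
    refine P.word_notMem hD (hseg _ _ (hφ hkl)) ?_
    have : (g (φ k))⁻¹ * g (φ l) = (j k)⁻¹ * j l := by
      rw [eq_inv_mul_iff_mul_eq, ← mul_assoc, ← eq_mul_inv_iff_mul_eq]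
      exact h
    rw [this]
    exact J.mul_mem (inv_mem (hj k)) (hj l)
  have hfi : Function.Injective f := fun k l h => by
    rcases lt_trichotomy k l with h' | h' | h'
    exacts [absurd h (hlt _ _ h'), h', absurd h.symm (hlt _ _ h')]
  obtain ⟨ψ, hψ, p, q, hpq⟩ := hGd f hfG hfi
  have hp : p ∈ B i := hpq.left_mem_of_frequently isOpen_interior (P.nonempty i) (P.closed i)
    (Eventually.frequently (Eventually.of_forall fun k y hy =>
      P.inv i _ (hj _) _ (hgB _ y (interior_subset hy))))
  have hfx : ∀ k, f k x ∈ C := fun k => by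
    have := hjC k _ (hcB (s (φ k)))
    simpa [hfd, hgd] using this
  obtain ⟨a, ha, χ, hχ, hχa⟩ := hC.isCompact.tendsto_subseq fun k => hfx (ψ k)
  have hap : a ≠ p := fun h => P.notMem_of_interior (hCB ha) (h ▸ hp)
  obtain rfl : x = q := by
    by_contra hne
    exact hap (tendsto_nhds_unique hχa ((hpq.tendsto_apply hne).comp hχ.tendsto_atTop))
  exact isConicalLimitPt_of_conicalSeq (fun k => hfG _)
    (hfi.comp (hψ.comp hχ).injective) hap (hpq.subseq hχ) hχa

lemma PingPong.exists_compact_of_boundedParabolic (P : PingPong A J G B) {i : Bool}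
    (hE : RelFinite A J i) {p : M} (hpA : p ∈ limitSet (A i))
    (hp : IsBoundedParabolicPt (A i) p) : ∃ K : Set M, IsClosed K ∧ p ∉ K ∧
      ∀ c ∈ A i, c⁻¹ p ∉ B i → ∃ h ∈ A i, h p = p ∧ ∀ x ∈ B i, h (c x) ∈ K := by
  obtain ⟨hpar, K₁, hK₁, hKs, hcov⟩ := hp
  by_contra hcon
  obtain ⟨U, hU⟩ := (𝓝 p).exists_antitone_basis
  have hbad : ∀ n, ∃ c ∈ A i, c⁻¹ p ∉ B i ∧ ∀ h ∈ A i, h p = p → ∃ x ∈ B i, h (c x) ∈ U n := by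
    intro n
    by_contra hn
    refine hcon ⟨(interior (U n))ᶜ, isOpen_interior.isClosed_compl,
      by simpa using mem_interior_iff_mem_nhds.2 (hU.mem n), fun c hc hcp => ?_⟩
    by_contra hh
    refine hn ⟨c, hc, hcp, fun h hhA hhp => ?_⟩
    by_contra hx
    exact hh ⟨h, hhA, hhp, fun x hxB hxU => hx ⟨x, hxB, interior_subset hxU⟩⟩
  choose c hc hcp hcU using hbad
  have hmove : ∀ᶠ n in atTop, c n p ≠ p := by
    by_contra hfr
    rw [← not_frequently, not_not] at hfr
    obtain ⟨n₀, hn₀⟩ := hfr.exists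
    refine hcp n₀ ?_
    rw [homeo_inv_apply_eq hn₀]
    refine (P.closed i).closure_subset (mem_closure_iff_nhds.2 fun V hV => ?_)
    obtain ⟨N, -, hN⟩ := hU.1.mem_iff.1 hV
    obtain ⟨n, hn, hNn⟩ := (hfr.and_eventually (eventually_ge_atTop N)).exists
    obtain ⟨x, hx, hxU⟩ := hcU n (c n)⁻¹ (inv_mem (hc n)) (homeo_inv_apply_eq hn)
    exact ⟨x, hN (hU.2 hNn (by simpa using hxU)), hx⟩
  obtain ⟨N, hN⟩ := eventually_atTop.1 hmove
  choose h hhA hhp hhK using fun n => hcov (c (n + N) p)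
    ⟨apply_mem_limitSet hpA (hc _), hN _ (by omega)⟩
  set d : ℕ → M ≃ₜ M := fun n => h n * c (n + N) with hdd
  have hdA : ∀ n, d n ∈ A i := fun n => (A i).mul_mem (hhA n) (hc _)
  have hdp : ∀ n, (d n)⁻¹ p ∉ B i := fun n => by
    simpa [hdd, mul_inv_rev, homeo_inv_apply_eq (hhp n)] using hcp (n + N)
  choose x hx hxU using fun n => hcU (n + N) (h n) (hhA n) (hhp n)
  have hxp : Tendsto (fun n => d n (x n)) atTop (𝓝 p) :=
    (hU.tendsto_right_iff.2 fun m _ => by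
      filter_upwards [eventually_ge_atTop m] with n hn
      exact hU.2 (show m ≤ n + N by omega) (hxU n))
  obtain ⟨φ, hφ, hcase⟩ := exists_subseq_coset J d
  rcases hcase with hcase | hcase
  · have hmem : p ∈ d (φ 0) '' B i := by
      refine ((d (φ 0)).isClosedMap _ (P.closed i)).mem_of_tendsto (hxp.comp hφ.tendsto_atTop)
        (Eventually.of_forall fun k => ⟨_, P.inv i _ (hcase 0 k) _ (hx (φ k)), by simp⟩)
    obtain ⟨y, hy, hyp⟩ := hmem
    exact hdp (φ 0) (homeo_eq_inv_apply hyp ▸ hy)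
  · obtain ⟨ψ, hψ, s, hs, z, e, -, he, hz⟩ := P.exists_shrinking hE (fun k => hdA (φ k)) hcase
    have hev := fun U (hU : U ∈ 𝓝 z) =>
      P.eventually_mem_of_shrinking (c := fun k => d (φ (ψ k))) hs he hz hU
    have hzp : z = p := tendsto_nhds_unique
      (f := fun k => d (φ (ψ k)) (x (φ (ψ k))))
      (fun U hU => (hev U hU).mono fun k hk => hk _ (hx _))
      (hxp.comp (hφ.comp hψ).tendsto_atTop)
    have hdi : Function.Injective fun k => d (φ (ψ k)) := fun k l hkl => by
      by_contra hne
      refine hcase (ψ k) (ψ l) (hψ.injective.ne hne) ?_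
      rw [show d (φ (ψ k)) = d (φ (ψ l)) from hkl, inv_mul_cancel]
      exact J.one_mem
    obtain ⟨χ, hχ, ζ, ρ, hζ⟩ := P.disc i _ (fun k => hdA (φ (ψ k))) hdi
    have hζK : ζ ∈ K₁ := hK₁.isClosed.mem_of_tendsto
      (hζ.tendsto_parabolicPt (P.disc i) hpar fun k => hdA _) (Eventually.of_forall fun k => hhK _)
    obtain ⟨y, hy, hyρ⟩ := exists_mem_ne_of_not_isOpen hζ.not_isOpen_right isOpen_interior
      (P.nonempty i)
    refine (hKs hζK).2 ((tendsto_nhds_unique (hζ.tendsto_apply hyρ) ?_).trans hzp)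
    exact fun U hU => hχ.tendsto_atTop.eventually
      ((hev U hU).mono fun k hk => hk y (interior_subset hy))

lemma PingPong.isBoundedParabolicPt_of_forall_notMem (P : PingPong A J G B) {i : Bool}
    (hE : RelFinite A J i) {p : M} (hpA : p ∈ limitSet (A i))
    (hp : IsBoundedParabolicPt (A i) p) (hpJ : ∀ c ∈ A i, c p ∉ limitSet J) :
    IsBoundedParabolicPt G p := by
  obtain ⟨K', hK', hpK', hcov'⟩ := P.exists_compact_of_boundedParabolic hE hpA hp
  obtain ⟨hpar, K, hK, hKs, hcov⟩ := hp
  have hAG := P.factor_le i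
  refine ⟨hpar.mono hAG, (K ∪ K') ∩ limitSet G,
    ((hK.isClosed.union hK').inter (isClosed_limitSet G)).isCompact, ?_, ?_⟩
  · rintro y ⟨hy | hy, hyG⟩
    · exact ⟨hyG, (hKs hy).2⟩
    · exact ⟨hyG, fun h => hpK' (by rw [← show y = p from h]; exact hy)⟩
  · rintro y ⟨hyG, hyp⟩
    rcases P.mem_limitSet_or_isWordLimit hE hyG with h | ⟨c, hc, h⟩
    · obtain ⟨g, hg, hgp, hgK⟩ := hcov y ⟨h, hyp⟩
      exact ⟨g, hAG hg, hgp, Or.inl hgK, apply_mem_limitSet hyG (hAG hg)⟩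
    · obtain ⟨g, hg, hgp, hgK⟩ := hcov' c hc (P.notMem_of_interior
        (P.lim i _ (apply_mem_limitSet hpA (inv_mem hc)) (hpJ _ (inv_mem hc))))
      refine ⟨g, hAG hg, hgp, Or.inr ?_, apply_mem_limitSet hyG (hAG hg)⟩
      have := hgK (c⁻¹ y) (by simpa using P.mem_of_isWordLimit h)
      rwa [homeo_apply_inv_self] at this

lemma PingPong.isBoundedParabolicPt_of_mem (P : PingPong A J G B)
    (hE : ∀ i, RelFinite A J i) {p : M} (hpJ : p ∈ limitSet J)
    (hp : ∀ i, IsBoundedParabolicPt (A i) p) : IsBoundedParabolicPt G p := by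
  have hpA : ∀ i, p ∈ limitSet (A i) := fun i => limitSet_mono (P.le i) hpJ
  choose K' hK' hpK' hcov' using fun i =>
    P.exists_compact_of_boundedParabolic (hE i) (hpA i) (hp i)
  choose hpar K hK hKs hcov using hp
  refine ⟨(hpar true).mono (P.factor_le true), (⋃ i, K i ∪ K' i) ∩ limitSet G,
    ((isClosed_iUnion_of_finite fun i => (hK i).isClosed.union (hK' i)).inter
      (isClosed_limitSet G)).isCompact, ?_, ?_⟩
  · rintro y ⟨hy, hyG⟩
    obtain ⟨i, hy | hy⟩ := mem_iUnion.1 hy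
    · exact ⟨hyG, (hKs i hy).2⟩
    · exact ⟨hyG, fun h => hpK' i (by rw [← show y = p from h]; exact hy)⟩
  · rintro y ⟨hyG, hyp⟩
    obtain ⟨i, h | ⟨c, hc, hcJ, h⟩⟩ := P.exists_mem_limitSet_or_mem_translate hE hyG
    · obtain ⟨g, hg, hgp, hgK⟩ := hcov i y ⟨h, hyp⟩
      exact ⟨g, P.factor_le i hg, hgp, mem_iUnion.2 ⟨i, Or.inl hgK⟩,
        apply_mem_limitSet hyG (P.factor_le i hg)⟩
    · obtain ⟨g, hg, hgp, hgK⟩ := hcov' i c hc (P.notMem_of_interior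
        (P.pp i _ (inv_mem hc) (fun h => hcJ (by simpa using inv_mem h)) p
          (P.limitSet_subset i hpJ)))
      refine ⟨g, P.factor_le i hg, hgp, mem_iUnion.2 ⟨i, Or.inr ?_⟩,
        apply_mem_limitSet hyG (P.factor_le i hg)⟩
      simpa using hgK _ h

lemma PingPong.relFinite_of_isGeomFinite_factor (P : PingPong A J G B) (hJ : IsGeomFinite J)
    {i : Bool} (hA : IsGeomFinite (A i)) : RelFinite A J i := by
  intro p hp
  rcases hJ p hp with h | h
  · exact Or.inl h
  rcases hA p (limitSet_mono (P.le i) hp) with h' | ⟨-, K, hK, hKs, hcov⟩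
  · exact absurd h' ((h.1.mono (P.le i)).not_isConicalLimitPt (P.disc i))
  · refine Or.inr ⟨h.1, K, hK, fun hpK => (hKs hpK).2 rfl, fun x hx hxp => ?_⟩
    obtain ⟨g, hg, hgp, hgK⟩ := hcov x ⟨hx, hxp⟩
    exact ⟨g, P.mem_of_apply_mem_limitSet (P.factor_le i hg) hp (by rwa [hgp]), hgp, hgK⟩

theorem PingPong.isGeomFinite_of_factors (P : PingPong A J G B) (hD : ¬ Degenerate A J B)
    (hGd : IsDiscreteConvGroup G) (hJ : IsGeomFinite J) (hA : ∀ i, IsGeomFinite (A i)) :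
    IsGeomFinite G := by
  have hE : ∀ i, RelFinite A J i := fun i => P.relFinite_of_isGeomFinite_factor hJ (hA i)
  have htrans : ∀ {x : M} (c : M ≃ₜ M), c ∈ G →
      (IsConicalLimitPt G (c x) ∨ IsBoundedParabolicPt G (c x)) →
      (IsConicalLimitPt G x ∨ IsBoundedParabolicPt G x) := by
    intro x c hc h
    refine h.imp (fun h => ?_) (fun h => ?_)
    · simpa using h.translate (inv_mem hc)
    · simpa using h.translate (inv_mem hc)
  have hptJ : ∀ p ∈ limitSet J, IsConicalLimitPt G p ∨ IsBoundedParabolicPt G p := by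
    intro p hp
    by_cases hcon : ∃ i, IsConicalLimitPt (A i) p
    · obtain ⟨i, hi⟩ := hcon
      exact Or.inl (hi.mono (P.factor_le i))
    · exact Or.inr (P.isBoundedParabolicPt_of_mem hE hp fun i =>
        (hA i p (limitSet_mono (P.le i) hp)).resolve_left fun h => hcon ⟨i, h⟩)
  have hptA : ∀ i, ∀ p ∈ limitSet (A i), IsConicalLimitPt G p ∨ IsBoundedParabolicPt G p := by
    intro i p hp
    by_cases hpJ : ∃ c ∈ A i, c p ∈ limitSet J
    · obtain ⟨c, hc, hcp⟩ := hpJ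
      exact htrans c (P.factor_le i hc) (hptJ _ hcp)
    · refine (hA i p hp).imp (fun h => h.mono (P.factor_le i)) fun h => ?_
      exact P.isBoundedParabolicPt_of_forall_notMem (hE i) hp h
        fun c hc hcp => hpJ ⟨c, hc, hcp⟩
  intro x hx
  by_cases hxA : ∃ g ∈ G, ∃ i, g x ∈ limitSet (A i)
  · obtain ⟨g, hg, i, hgx⟩ := hxA
    exact htrans g hg (hptA i _ hgx)
  · have hxA' : ∀ g ∈ G, ∀ i, g x ∉ limitSet (A i) := fun g hg i h => hxA ⟨g, hg, i, h⟩
    obtain ⟨c, hc, hcx⟩ := (P.mem_limitSet_or_isWordLimit (hE true) hx).resolve_left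
      (hxA' 1 (one_mem _) true)
    have hcG := inv_mem (P.factor_le true hc)
    exact htrans c⁻¹ hcG (Or.inl (P.isConicalLimitPt_of_isWordLimit hD hGd hE hcx
      fun g hg i => hxA' (g * c⁻¹) (G.mul_mem hg hcG) i))

end Amalgam
section Regularization

lemma limitSet_eq_empty_of_finite [Finite M] (G : Subgroup (M ≃ₜ M)) : limitSet G = ∅ := by
  have : Finite (M ≃ₜ M) := DFunLike.finite _
  refine eq_empty_iff_forall_notMem.2 ?_
  rintro x ⟨g, -, hg, -⟩
  exact not_injective_infinite_finite g hg

lemma isGeomFinite_of_limitSet_eq_empty {G : Subgroup (M ≃ₜ M)} (h : limitSet G = ∅) :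
    IsGeomFinite G := fun x hx => by simp [h] at hx

lemma interior_closure_interior_of_isClosed {B : Set M} (hB : IsClosed B) :
    interior (closure (interior B)) = interior B :=
  (interior_mono (hB.closure_subset_iff.2 interior_subset)).antisymm
    (interior_maximal subset_closure isOpen_interior)

/-- The ping-pong sets may be replaced by the closures of their interiors. -/
lemma AFPPingPong.pingPong {G₁ G₂ J : Subgroup (M ≃ₜ M)} {B₁ B₂ : Set M}
    (h : AFPPingPong G₁ G₂ J B₁ B₂) (hd₁ : IsDiscreteConvGroup G₁)
    (hd₂ : IsDiscreteConvGroup G₂) (h₁ : J < G₁) (h₂ : J < G₂) :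
    PingPong (fun b => cond b G₁ G₂) J (G₁ ⊔ G₂)
      fun b => closure (interior (cond b B₁ B₂)) := by
  have e₁ := interior_closure_interior_of_isClosed h.isClosed₁
  have e₂ := interior_closure_interior_of_isClosed h.isClosed₂
  have s₁ : closure (interior B₁) ⊆ B₁ := h.isClosed₁.closure_subset_iff.2 interior_subset
  have s₂ : closure (interior B₂) ⊆ B₂ := h.isClosed₂.closure_subset_iff.2 interior_subset
  have hinv : ∀ {B : Set M} {j : M ≃ₜ M}, ⇑j '' B = B → ∀ x ∈ closure (interior B),
      j x ∈ closure (interior B) := by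
    intro B j hj x hx
    have := mem_image_of_mem j hx
    rwa [j.image_closure, j.image_interior, hj] at this
  have hdisj := disjoint_iff_inter_eq_empty.2 h.int_disjoint
  constructor
  · rintro (_ | _)
    exacts [hd₂, hd₁]
  · rintro (_ | _)
    exacts [h₂.le, h₁.le]
  · rintro (_ | _)
    exacts [SetLike.exists_of_lt h₂, SetLike.exists_of_lt h₁]
  · rfl
  · exact fun _ => isClosed_closure
  · rintro (_ | _)
    exacts [e₂.symm ▸ h.int_nonempty₂, e₁.symm ▸ h.int_nonempty₁]
  · rintro (_ | _)
    · exact e₂.symm ▸ hdisj.symm.closure_right isOpen_interior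
    · exact e₁.symm ▸ hdisj.closure_right isOpen_interior
  · rintro (_ | _) j hj
    exacts [hinv (h.inv₂ j hj), hinv (h.inv₁ j hj)]
  · rintro (_ | _) g hg hgJ x hx
    · exact e₁.symm ▸ h.pp₂ g hg hgJ (mem_image_of_mem g (s₂ hx))
    · exact e₂.symm ▸ h.pp₁ g hg hgJ (mem_image_of_mem g (s₁ hx))
  · rintro (_ | _) x hx hxJ
    · exact e₁.symm ▸ h.lim₂ ⟨hx, hxJ⟩
    · exact e₂.symm ▸ h.lim₁ ⟨hx, hxJ⟩

end Regularization

/-- **Theorem A(iv).** With `G₁, G₂` discrete convergence groups in AFP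
ping-pong position with respect to the geometrically finite proper subgroup
`J = G₁ ∩ G₂`, and `G = ⟨G₁, G₂⟩` acting as a convergence group, `G` is geometrically
finite if and only if both `G₁` and `G₂` are geometrically finite. -/
theorem statement_7 {M : Type*} [TopologicalSpace M] [CompactSpace M]
    [TopologicalSpace.MetrizableSpace M]
    (G₁ G₂ J G : Subgroup (M ≃ₜ M))
    (hd₁ : IsDiscreteConvGroup G₁) (hd₂ : IsDiscreteConvGroup G₂)
    (hJ : J = G₁ ⊓ G₂) (hJgf : IsGeomFinite J) (hJlt₁ : J < G₁) (hJlt₂ : J < G₂)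
    (hpp : ∃ B₁ B₂ : Set M, AFPPingPong G₁ G₂ J B₁ B₂)
    (hG : G = G₁ ⊔ G₂) (hGconv : IsConvGroup G) :
    IsGeomFinite G ↔ IsGeomFinite G₁ ∧ IsGeomFinite G₂ := by
  obtain ⟨B₁, B₂, hB⟩ := hpp
  subst hG
  rcases finite_or_infinite M with hM | hM
  · have := fun G : Subgroup (M ≃ₜ M) =>
      isGeomFinite_of_limitSet_eq_empty (limitSet_eq_empty_of_finite G)
    exact iff_of_true (this _) ⟨this _, this _⟩
  have P := hB.pingPong hd₁ hd₂ hJlt₁ hJlt₂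
  by_cases hD : Degenerate (fun b => cond b G₁ G₂) J fun b => closure (interior (cond b B₁ B₂))
  · have h := P.limitSet_eq_empty_of_degenerate hD
    have := fun {H : Subgroup (M ≃ₜ M)} (hH : H ≤ G₁ ⊔ G₂) =>
      isGeomFinite_of_limitSet_eq_empty (subset_eq_empty (limitSet_mono hH) h)
    exact iff_of_true (this le_rfl) ⟨this le_sup_left, this le_sup_right⟩
  have hGd := P.isDiscreteConvGroup hD hGconv
  constructor
  · exact fun h => ⟨P.isGeomFinite_factor hGd hJgf h true, P.isGeomFinite_factor hGd hJgf h false⟩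
  · rintro ⟨h₁, h₂⟩
    refine P.isGeomFinite_of_factors hD hGd hJgf ?_
    rintro (_ | _)
    exacts [h₂, h₁]

end ConvergenceGroups
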